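/- Let A be a primitive set all of whose elements are odd. Then f(A) ≤ ∑_{p ∈ 𝒫(A)} 1/(p·log p) + ε₀, where 𝒫(A) is the set of primes dividing some member of A and ε₀ = ∑_{p prime, p>2, p not Mertens} (e^γ·g(p) − 1/(p·log p)). -/

import Mathlib

open scoped BigOperators

/-- A set of positive integers is *primitive* if every element exceeds 1 and
no element divides another element. -/
def IsPrimitive (A : Set ℕ) : Prop :=
  (∀ a ∈ A, 1 < a) ∧ ∀ a ∈ A, ∀ b ∈ A, a ≠ b → ¬ a ∣ b

/-- `f A = ∑_{a ∈ A} 1/(a log a)`. -/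
noncomputable def f (A : Set ℕ) : ℝ :=
  ∑' a : A, 1 / ((a : ℕ) * Real.log (a : ℕ))

/-- The support `𝒫(A)` of a set `A`: the primes dividing some member of `A`. -/
def primeSupport (A : Set ℕ) : Set ℕ :=
  {p : ℕ | p.Prime ∧ ∃ a ∈ A, p ∣ a}

/-- `g p = (1/p) ∏_{r prime, r < p} (1 - 1/r)`. -/
noncomputable def g (p : ℕ) : ℝ :=
  (1 / p) * ∏ r ∈ p.primesBelow, (1 - 1 / (r : ℝ))

/-- A prime `q` is *Mertens* if `e^γ ∏_{r < q} (1 - 1/r) ≤ 1/log q`. -/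
def IsMertens (q : ℕ) : Prop :=
  Real.exp Real.eulerMascheroniConstant * ∏ r ∈ q.primesBelow, (1 - 1 / (r : ℝ)) ≤
    1 / Real.log q

/-- `ε₀ = ∑_{p odd prime, p not Mertens} (e^γ g(p) - 1/(p log p))`. -/
noncomputable def eps0 : ℝ :=
  ∑' p : {p : ℕ // p.Prime ∧ 2 < p ∧ ¬ IsMertens p},
    (Real.exp Real.eulerMascheroniConstant * g p -
      1 / ((p : ℕ) * Real.log (p : ℕ)))

section
open ArithmeticFunction Finset

/-- Legendre's formula. -/
theorem log_factorial_eq_sum_vonMangoldt {N K : ℕ} (h : N ≤ K) :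
    Real.log (N.factorial : ℝ) = ∑ n ∈ Ioc 0 K, Λ n * ((N / n : ℕ) : ℝ) := by
  have h1 := sum_Ioc_mul_zeta_eq_sum (Λ) N
  rw [vonMangoldt_mul_zeta] at h1
  have h2 : Real.log (N.factorial : ℝ) = ∑ n ∈ Ioc 0 N, ArithmeticFunction.log n := by
    have e : Ioc 0 N = Ico 1 (N + 1) := by
      ext i
      simp only [mem_Ioc, mem_Ico]
      omega
    rw [← Finset.prod_Ico_id_eq_factorial, e]
    push_cast
    rw [Real.log_prod]
    · rfl
    · intro i hi
      simp only [mem_Ico] at hi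
      have : (0 : ℝ) < i := by exact_mod_cast hi.1
      exact this.ne'
  rw [h2, h1]
  refine sum_subset (Ioc_subset_Ioc_right h) ?_
  intro n hn hn'
  simp only [mem_Ioc, not_and, not_le] at hn hn'
  rw [Nat.div_eq_of_lt (hn' hn.1)]
  simp

theorem factorial_lower (N : ℕ) :
    N * Real.log (N + 1) - N ≤ Real.log (N.factorial : ℝ) := by
  induction N with
  | zero => simp
  | succ n ih =>
    rw [Nat.factorial_succ]
    push_cast
    rw [Real.log_mul (by positivity) (by positivity)]
    have h : Real.log ((n + 1 + 1 : ℝ) / (n + 1)) ≤ (n + 1 + 1 : ℝ) / (n + 1) - 1 :=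
      Real.log_le_sub_one_of_pos (by positivity)
    rw [Real.log_div (by positivity) (by positivity)] at h
    have h3 : (n + 1 + 1 : ℝ) / (n + 1) - 1 = 1 / (n + 1) := by field_simp; ring
    rw [h3] at h
    have h4 := mul_le_mul_of_nonneg_left h (by positivity : (0 : ℝ) ≤ n + 1)
    rw [mul_one_div_cancel (by positivity)] at h4
    nlinarith

theorem factorial_upper {N : ℕ} (hN : 1 ≤ N) :
    Real.log (N.factorial : ℝ) ≤ N * Real.log N - N + 1 + Real.log N := by
  induction N, hN using Nat.le_induction with
  | base => simp
  | succ n hn ih =>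
    rw [Nat.factorial_succ]
    push_cast
    rw [Real.log_mul (by positivity) (by positivity)]
    have hn0 : (0 : ℝ) < n := by exact_mod_cast hn
    have h : Real.log ((n : ℝ) / (n + 1)) ≤ (n : ℝ) / (n + 1) - 1 :=
      Real.log_le_sub_one_of_pos (by positivity)
    rw [Real.log_div (by positivity) (by positivity)] at h
    have h3 : (n : ℝ) / (n + 1) - 1 = - (1 / (n + 1)) := by field_simp; ring
    rw [h3] at h
    have h4 := mul_le_mul_of_nonneg_left h (by positivity : (0 : ℝ) ≤ n + 1)
    rw [mul_neg, mul_one_div_cancel (by positivity)] at h4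
    nlinarith

theorem psi_le_log_factorial (N : ℕ) : Chebyshev.psi N ≤ Real.log (N.factorial : ℝ) := by
  rw [log_factorial_eq_sum_vonMangoldt le_rfl, Chebyshev.psi, Nat.floor_natCast]
  refine sum_le_sum fun n hn => ?_
  simp only [mem_Ioc] at hn
  have : (1 : ℝ) ≤ ((N / n : ℕ) : ℝ) := by
    exact_mod_cast (Nat.one_le_div_iff hn.1).2 hn.2
  nlinarith [vonMangoldt_nonneg (n := n)]

theorem psi_eq_sum_ite {m N : ℕ} (h : m ≤ N) :
    Chebyshev.psi m = ∑ n ∈ Ioc 0 N, Λ n * (if n ≤ m then 1 else 0) := by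
  rw [Chebyshev.psi, Nat.floor_natCast]
  rw [← sum_subset (Ioc_subset_Ioc_right h)]
  · refine sum_congr rfl fun n hn => ?_
    simp only [mem_Ioc] at hn
    simp [hn.2]
  · intro n hn hn'
    simp only [mem_Ioc, not_and, not_le] at hn hn'
    simp [hn' hn.1]

theorem psi_sub_psi_div_six_le (N : ℕ) :
    Chebyshev.psi N - Chebyshev.psi (N / 6 : ℕ) ≤
      Real.log (N.factorial : ℝ) - Real.log ((N / 2).factorial : ℝ)
        - Real.log ((N / 3).factorial : ℝ) - Real.log ((N / 6).factorial : ℝ) := by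
  rw [log_factorial_eq_sum_vonMangoldt (le_refl N),
    log_factorial_eq_sum_vonMangoldt (Nat.div_le_self N 2),
    log_factorial_eq_sum_vonMangoldt (Nat.div_le_self N 3),
    log_factorial_eq_sum_vonMangoldt (Nat.div_le_self N 6),
    psi_eq_sum_ite (Nat.div_le_self N 6), psi_eq_sum_ite (le_refl N),
    ← sum_sub_distrib, ← sum_sub_distrib, ← sum_sub_distrib, ← sum_sub_distrib]
  refine sum_le_sum fun n hn => ?_
  simp only [mem_Ioc] at hn
  simp only [← mul_sub]
  refine mul_le_mul_of_nonneg_left ?_ vonMangoldt_nonneg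
  rw [Nat.div_div_eq_div_mul, Nat.div_div_eq_div_mul, Nat.div_div_eq_div_mul,
    mul_comm 2, mul_comm 3, mul_comm 6, ← Nat.div_div_eq_div_mul, ← Nat.div_div_eq_div_mul,
    ← Nat.div_div_eq_div_mul]
  have h6 : n ≤ N / 6 ↔ 6 ≤ N / n := by
    rw [Nat.le_div_iff_mul_le (by norm_num), Nat.le_div_iff_mul_le hn.1, mul_comm]
  have h1 : 1 ≤ N / n := (Nat.one_le_div_iff hn.1).2 hn.2
  rw [if_pos hn.2]
  simp only [h6]
  generalize N / n = m at *
  have key : m / 2 + m / 3 + m / 6 + 1 ≤ m + (if 6 ≤ m then 1 else 0) := by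
    split_ifs <;> omega
  have key' : ((m / 2 : ℕ) : ℝ) + ((m / 3 : ℕ) : ℝ) + ((m / 6 : ℕ) : ℝ) + 1
    ≤ (m : ℝ) + (if 6 ≤ m then 1 else 0) := by
    have := (Nat.cast_le (α := ℝ)).2 key
    push_cast at this ⊢
    simpa using this
  linarith

theorem log_factorial_div_ge {N d : ℕ} (hd : 1 ≤ d) (hN : d * 3 ≤ N) :
    ((N : ℝ) / d - (d - 1) / d) * (Real.log N - Real.log d - 1) ≤
      Real.log ((N / d).factorial : ℝ) := by
  refine le_trans ?_ (factorial_lower (N / d))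
  have hd0 : (0 : ℝ) < d := by exact_mod_cast hd
  have hNd : (d : ℝ) * 3 ≤ N := by exact_mod_cast hN
  have hN0 : (0 : ℝ) < N := by nlinarith
  have h1 : (N : ℝ) + 1 ≤ d * (((N / d : ℕ) : ℝ) + 1) := by
    have : N + 1 ≤ d * (N / d + 1) := by
      have := Nat.lt_mul_div_succ N (by omega : 0 < d)
      omega
    exact_mod_cast this
  have h2 : (N : ℝ) / d - (d - 1) / d ≤ ((N / d : ℕ) : ℝ) := by
    rw [← sub_div, div_le_iff₀ hd0]
    linarith
  have h3 : (N : ℝ) / d ≤ ((N / d : ℕ) : ℝ) + 1 := by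
    rw [div_le_iff₀ hd0]; linarith
  rw [← Real.log_div (by positivity) (by positivity)]
  have h4 : Real.log ((N : ℝ) / d) ≤ Real.log (((N / d : ℕ) : ℝ) + 1) :=
    Real.log_le_log (by positivity) h3
  have h5 : 1 ≤ Real.log ((N : ℝ) / d) := by
    rw [Real.le_log_iff_exp_le (by positivity)]
    have : (3 : ℝ) ≤ N / d := by rw [le_div_iff₀ hd0]; linarith
    linarith [Real.exp_one_lt_d9]
  have h6 : (0 : ℝ) ≤ ((N / d : ℕ) : ℝ) := by positivity
  nlinarith

/-- The constant `(log 2)/2 + (log 3)/3 + (log 6)/6`. -/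
noncomputable def chebA : ℝ := 2 / 3 * Real.log 2 + 1 / 2 * Real.log 3

theorem psi_le_chebA (N : ℕ) (hN : 1 ≤ N) :
    Chebyshev.psi N ≤ 6 / 5 * chebA * N + Real.log N ^ 2 + 34 := by
  induction N using Nat.strong_induction_on with
  | _ N ih =>
  have hl2 := Real.log_two_gt_d9
  have hl3 := Real.log_three_gt_d9
  have hl2' := Real.log_two_lt_d9
  have hl3' := Real.log_three_lt_d9
  have hA : 0 ≤ chebA := by unfold chebA; nlinarith
  rcases lt_or_ge N 18 with h | h
  · have h1 : Chebyshev.psi N ≤ Chebyshev.psi (17 : ℕ) :=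
      Chebyshev.psi_mono (by exact_mod_cast (by omega : N ≤ 17))
    have h2 := psi_le_log_factorial 17
    have h3 : Real.log ((17 : ℕ).factorial : ℝ) ≤ 34 := by
      have : ((17 : ℕ).factorial : ℝ) ≤ 2 ^ 49 := by norm_num [Nat.factorial]
      have h4 := Real.log_le_log (by positivity) this
      rw [Real.log_pow] at h4
      push_cast at h4
      linarith
    have : 0 ≤ 6 / 5 * chebA * N := by positivity
    nlinarith [sq_nonneg (Real.log N)]
  · have h6 := ih (N / 6) (by omega) (by omega)
    have hs := psi_sub_psi_div_six_le N
    have hu := factorial_upper hN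
    have e2 := log_factorial_div_ge (N := N) (d := 2) (by norm_num) (by omega)
    have e3 := log_factorial_div_ge (N := N) (d := 3) (by norm_num) (by omega)
    have e6 := log_factorial_div_ge (N := N) (d := 6) (by norm_num) (by omega)
    have hl6 : Real.log 6 = Real.log 2 + Real.log 3 := by
      rw [← Real.log_mul (by norm_num) (by norm_num)]; norm_num
    push_cast at e2 e3 e6
    rw [hl6] at e6
    have hN0 : (18 : ℝ) ≤ N := by exact_mod_cast h
    have h7 : ((N / 6 : ℕ) : ℝ) ≤ N / 6 := Nat.cast_div_le
    have h8 : (1 : ℝ) ≤ ((N / 6 : ℕ) : ℝ) := by exact_mod_cast (by omega : 1 ≤ N / 6)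
    have h9 : Real.log ((N / 6 : ℕ) : ℝ) ≤ Real.log N - Real.log 2 - Real.log 3 := by
      have := Real.log_le_log (by linarith) h7
      rw [Real.log_div (by positivity) (by norm_num), hl6] at this
      linarith
    have h10 : 0 ≤ Real.log ((N / 6 : ℕ) : ℝ) := Real.log_nonneg h8
    have h11 : Real.log ((N / 6 : ℕ) : ℝ) ^ 2 ≤ (Real.log N - Real.log 2 - Real.log 3) ^ 2 :=
      pow_le_pow_left₀ h10 h9 2
    have h12 : 6 / 5 * chebA * ((N / 6 : ℕ) : ℝ) ≤ 6 / 5 * chebA * (N / 6) := by gcongr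
    have hL : 2 ≤ Real.log N := by
      have : Real.log 18 ≤ Real.log N := Real.log_le_log (by norm_num) hN0
      have e : Real.log 18 = Real.log 2 + 2 * Real.log 3 := by
        rw [show (18 : ℝ) = 2 * 3 ^ 2 by norm_num, Real.log_mul (by norm_num) (by norm_num),
          Real.log_pow]; norm_num
      linarith
    unfold chebA at *
    generalize Real.log N = L at *
    generalize Real.log 2 = a at *
    generalize Real.log 3 = b at *
    have key : Chebyshev.psi N ≤ (2 / 3 * a + 1 / 2 * b) * N + 3 * L - 1 - (a / 2 + 2 / 3 * b + 5 / 6 * (a + b))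
       + Chebyshev.psi (N / 6 : ℕ) := by
      linarith
    nlinarith
end

section
open ArithmeticFunction Finset

/-- The partial sums `∑_{n ≤ N} Λ(n)/n`. -/
noncomputable def vonMangoldtSum (N : ℕ) : ℝ := ∑ n ∈ Ioc 0 N, Λ n / n

/-- The partial sums `∑_{n ≤ N} Λ(n)/(n log n)`. -/
noncomputable def vonMangoldtLogSum (N : ℕ) : ℝ := ∑ n ∈ Ioc 0 N, Λ n / (n * Real.log n)

theorem vonMangoldtSum_lower {N : ℕ} (hN : 1 ≤ N) :
    Real.log (N + 1) - 1 ≤ vonMangoldtSum N := by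
  have hN0 : (0 : ℝ) < N := by exact_mod_cast hN
  have h1 : Real.log (N.factorial : ℝ) ≤ N * vonMangoldtSum N := by
    rw [log_factorial_eq_sum_vonMangoldt le_rfl, vonMangoldtSum, mul_sum]
    refine sum_le_sum fun n hn => ?_
    have h2 : ((N / n : ℕ) : ℝ) ≤ N / n := Nat.cast_div_le
    calc Λ n * ((N / n : ℕ) : ℝ) ≤ Λ n * (N / n) :=
          mul_le_mul_of_nonneg_left h2 vonMangoldt_nonneg
      _ = N * (Λ n / n) := by ring
  have h2 := factorial_lower N
  have h3 : N * (Real.log (N + 1) - 1) ≤ N * vonMangoldtSum N := by linarith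
  exact le_of_mul_le_mul_left h3 hN0

theorem fract_div_le_count {n N : ℕ} (h0 : 0 < n) (h : n ≤ N) :
    (N : ℝ) / n - ((N / n : ℕ) : ℝ) ≤
      1 / 4 * ((if n ≤ 4 * N / 4 then 1 else 0) + (if n ≤ 4 * N / 5 then 1 else 0) +
        (if n ≤ 4 * N / 6 then 1 else 0) + (if n ≤ 4 * N / 7 then 1 else 0)) := by
  have hn0 : (0 : ℝ) < n := by exact_mod_cast h0
  have hN : N = n * (N / n) + N % n := (Nat.div_add_mod N n).symm
  have hr : N % n < n := Nat.mod_lt _ h0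
  have hm : 1 ≤ N / n := (Nat.one_le_div_iff h0).2 h
  have h1 : (N : ℝ) / n - ((N / n : ℕ) : ℝ) = ((N % n : ℕ) : ℝ) / n := by
    have : (N : ℝ) = n * ((N / n : ℕ) : ℝ) + ((N % n : ℕ) : ℝ) := by exact_mod_cast hN
    rw [eq_div_iff hn0.ne', sub_mul, div_mul_cancel₀ _ hn0.ne']
    linarith
  rw [h1, div_le_iff₀ hn0]
  simp only [Nat.le_div_iff_mul_le (show 0 < 4 by norm_num),
    Nat.le_div_iff_mul_le (show 0 < 5 by norm_num),
    Nat.le_div_iff_mul_le (show 0 < 6 by norm_num),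
    Nat.le_div_iff_mul_le (show 0 < 7 by norm_num)]
  have h2 : n + N % n ≤ N := by nlinarith
  have hr' : ((N % n : ℕ) : ℝ) < n := by exact_mod_cast hr
  have h2' : (n : ℝ) + ((N % n : ℕ) : ℝ) ≤ N := by exact_mod_cast h2
  have c4 : n * 4 ≤ 4 * N := by omega
  rw [if_pos c4]
  generalize N % n = r at *
  split_ifs with a b c c b c c
  all_goals
    try have a' : (4 * N : ℝ) < n * 5 := by exact_mod_cast not_le.1 a
    try have b' : (4 * N : ℝ) < n * 6 := by exact_mod_cast not_le.1 b
    try have c' : (4 * N : ℝ) < n * 7 := by exact_mod_cast not_le.1 c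
    linarith

theorem vonMangoldtSum_mul_le (N : ℕ) :
    N * vonMangoldtSum N ≤ Real.log (N.factorial : ℝ) + 1 / 4 * (Chebyshev.psi N +
      Chebyshev.psi (4 * N / 5 : ℕ) + Chebyshev.psi (4 * N / 6 : ℕ) +
      Chebyshev.psi (4 * N / 7 : ℕ)) := by
  have e4 : 4 * N / 4 = N := by omega
  have e : Chebyshev.psi N = Chebyshev.psi (4 * N / 4 : ℕ) := by rw [e4]
  rw [e, log_factorial_eq_sum_vonMangoldt le_rfl, vonMangoldtSum, mul_sum,
    psi_eq_sum_ite (show 4 * N / 4 ≤ N by omega), psi_eq_sum_ite (show 4 * N / 5 ≤ N by omega),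
    psi_eq_sum_ite (show 4 * N / 6 ≤ N by omega), psi_eq_sum_ite (show 4 * N / 7 ≤ N by omega),
    ← sum_add_distrib, ← sum_add_distrib, ← sum_add_distrib, mul_sum, ← sum_add_distrib]
  refine sum_le_sum fun n hn => ?_
  simp only [mem_Ioc] at hn
  have := mul_le_mul_of_nonneg_left (fract_div_le_count hn.1 hn.2) (vonMangoldt_nonneg (n := n))
  calc N * (Λ n / n) = Λ n * (N / n - ((N / n : ℕ) : ℝ)) + Λ n * ((N / n : ℕ) : ℝ) := by ring
    _ ≤ _ := by linarith

theorem vonMangoldtSum_upper {N : ℕ} (hN : 2 ≤ N) :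
    vonMangoldtSum N + 1 ≤
      Real.log N + 0.9219 + (Real.log N ^ 2 + Real.log N + 35) / N := by
  have hN0 : (2 : ℝ) ≤ N := by exact_mod_cast hN
  have hL : 0 ≤ Real.log N := Real.log_nonneg (by linarith)
  have hc : 0 ≤ chebA := by
    unfold chebA; nlinarith [Real.log_two_gt_d9, Real.log_three_gt_d9]
  have hc' : 6 / 5 * chebA * (319 / 420) ≤ 0.9219 := by
    unfold chebA; nlinarith [Real.log_two_lt_d9, Real.log_three_lt_d9]
  have key (d : ℕ) (hd : 4 ≤ d) (hd' : d ≤ 7) : Chebyshev.psi (4 * N / d : ℕ) ≤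
      6 / 5 * chebA * (4 * N / d) + Real.log N ^ 2 + 34 := by
    have h1 : 1 ≤ 4 * N / d := by
      rw [Nat.one_le_div_iff (by omega)]; omega
    have h2 : ((4 * N / d : ℕ) : ℝ) ≤ 4 * N / d := by
      have : ((4 * N / d : ℕ) : ℝ) ≤ ((4 * N : ℕ) : ℝ) / d := Nat.cast_div_le
      push_cast at this; exact this
    have h1' : (1 : ℝ) ≤ ((4 * N / d : ℕ) : ℝ) := by exact_mod_cast h1
    have h3 : 4 * N / d ≤ N := by
      calc 4 * N / d ≤ 4 * N / 4 := Nat.div_le_div_left hd (by norm_num)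
        _ = N := by omega
    have h4 : Real.log ((4 * N / d : ℕ) : ℝ) ≤ Real.log N :=
      Real.log_le_log (by linarith) (by exact_mod_cast h3)
    have h5 := psi_le_chebA _ h1
    have h6 : Real.log ((4 * N / d : ℕ) : ℝ) ^ 2 ≤ Real.log N ^ 2 :=
      pow_le_pow_left₀ (Real.log_nonneg h1') h4 2
    have h7 := mul_le_mul_of_nonneg_left h2 (by positivity : 0 ≤ 6 / 5 * chebA)
    linarith
  have h1 := vonMangoldtSum_mul_le N
  have k0 := psi_le_chebA N (by omega)
  have k5 := key 5 (by norm_num) (by norm_num)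
  have k6 := key 6 (by norm_num) (by norm_num)
  have k7 := key 7 (by norm_num) (by norm_num)
  have hu := factorial_upper (show 1 ≤ N by omega)
  push_cast at k5 k6 k7
  have h2 : N * (vonMangoldtSum N + 1) ≤ N * (Real.log N + 0.9219 +
      (Real.log N ^ 2 + Real.log N + 35) / N) := by
    rw [mul_add (N : ℝ) (_ + _) (_ / _), mul_div_cancel₀ _ (by positivity)]
    nlinarith
  exact le_of_mul_le_mul_left h2 (by positivity)

theorem monotone_vonMangoldtLogSum_sub {N K : ℕ} (hN : 1 ≤ N) (h : N ≤ K) :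
    vonMangoldtLogSum N - Real.log (Real.log (N + 1))
        - (vonMangoldtSum N + 1) / Real.log (N + 1) ≤
      vonMangoldtLogSum K - Real.log (Real.log (K + 1))
        - (vonMangoldtSum K + 1) / Real.log (K + 1) := by
  induction K, h using Nat.le_induction with
  | base => exact le_rfl
  | succ K hK ih =>
    refine ih.trans ?_
    have hF : vonMangoldtLogSum (K + 1) = vonMangoldtLogSum K +
        Λ (K + 1) / ((K + 1) * Real.log (K + 1)) := by
      unfold vonMangoldtLogSum
      rw [← insert_Ioc_right_eq_Ioc_add_one (Nat.zero_le K), sum_insert (by simp)]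
      push_cast
      ring
    have hM : vonMangoldtSum (K + 1) = vonMangoldtSum K + Λ (K + 1) / (K + 1) := by
      unfold vonMangoldtSum
      rw [← insert_Ioc_right_eq_Ioc_add_one (Nat.zero_le K), sum_insert (by simp)]
      push_cast
      ring
    have hlow := vonMangoldtSum_lower (show 1 ≤ K + 1 by omega)
    push_cast at hlow ⊢
    have hK0 : (1 : ℝ) ≤ K := by exact_mod_cast hN.trans hK
    have hb : 0 < Real.log ((K : ℝ) + 1) := Real.log_pos (by linarith)
    have hb' : Real.log ((K : ℝ) + 1) ≤ Real.log ((K : ℝ) + 1 + 1) :=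
      Real.log_le_log (by linarith) (by linarith)
    rw [hF]
    have hM' : vonMangoldtSum K = vonMangoldtSum (K + 1) - Λ (K + 1) / (K + 1) := by linarith
    rw [hM']
    generalize vonMangoldtSum (K + 1) = M at *
    generalize Real.log ((K : ℝ) + 1 + 1) = b' at *
    have ha : Λ (K + 1) / ((K + 1) * Real.log (K + 1)) =
        Λ (K + 1) / (K + 1) / Real.log (K + 1) := by rw [div_div]
    rw [ha]
    generalize Λ (K + 1) / ((K : ℝ) + 1) = a at *
    generalize Real.log ((K : ℝ) + 1) = b at *
    have hb0 : 0 < b' := by linarith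
    have hlog := Real.log_le_sub_one_of_pos (show 0 < b' / b by positivity)
    rw [Real.log_div hb0.ne' hb.ne'] at hlog
    have e : (M + 1) * (1 / b - 1 / b') ≥ b' * (1 / b - 1 / b') :=
      mul_le_mul_of_nonneg_right (by linarith)
        (by rw [sub_nonneg]; exact one_div_le_one_div_of_le hb hb')
    have e2 : b' * (1 / b - 1 / b') = b' / b - 1 := by field_simp
    have e3 : (M + 1) * (1 / b - 1 / b') = (M + 1) / b - (M + 1) / b' := by ring
    have e4 : (M - a + 1) / b = (M + 1) / b - a / b := by ring
    rw [e4]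
    linarith
end

section
open ArithmeticFunction Finset

theorem sum_mul_ge_of_antitone {a w : ℕ → ℝ} {m N : ℕ} (ha : ∀ n, 0 ≤ a n)
    (hw : ∀ n, 0 < n → w (n + 1) ≤ w n) (h : m ≤ N) :
    ∑ n ∈ Ico m N, (∑ k ∈ Ioc 0 n, a k) * (w n - w (n + 1)) + (∑ k ∈ Ioc 0 N, a k) * w N ≤
      ∑ n ∈ Ioc 0 N, a n * w n := by
  have hanti : ∀ i j, 0 < i → i ≤ j → w j ≤ w i := by
    intro i j hi hij
    induction j, hij using Nat.le_induction with
    | base => exact le_rfl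
    | succ j hj ih => exact (hw j (by omega)).trans ih
  induction N, h using Nat.le_induction with
  | base =>
    simp only [Ico_self, sum_empty, zero_add, sum_mul]
    refine sum_le_sum fun n hn => ?_
    simp only [mem_Ioc] at hn
    exact mul_le_mul_of_nonneg_left (hanti _ _ hn.1 hn.2) (ha n)
  | succ N hN ih =>
    rw [sum_Ico_succ_top hN, ← insert_Ioc_right_eq_Ioc_add_one (Nat.zero_le N),
      sum_insert (by simp), sum_insert (by simp)]
    nlinarith

theorem integral_exp_neg_mul (δ x y : ℝ) :
    ∫ u in x..y, δ * Real.exp (-(δ * u)) = Real.exp (-(δ * x)) - Real.exp (-(δ * y)) := by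
  have := intervalIntegral.integral_eq_sub_of_hasDerivAt (a := x) (b := y)
    (f := fun u => - Real.exp (-(δ * u))) (f' := fun u => δ * Real.exp (-(δ * u)))
    (fun u _ => by
      have h1 : HasDerivAt (fun u : ℝ => -(δ * u)) (-(δ * 1)) u :=
        ((hasDerivAt_id u).const_mul δ).neg
      refine h1.exp.neg.congr_deriv ?_
      ring)
    (Continuous.intervalIntegrable (by fun_prop) _ _)
  rw [this]
  ring

theorem natCast_rpow_neg_eq_exp {n : ℕ} (hn : 0 < n) (δ : ℝ) :
    (n : ℝ) ^ (-δ) = Real.exp (-(δ * Real.log n)) := by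
  rw [Real.rpow_def_of_pos (by exact_mod_cast hn)]
  ring_nf

theorem intervalIntegrable_rpow_mul_exp {x y : ℝ} (hx : 0 < x) (hxy : x ≤ y) (s δ : ℝ) :
    IntervalIntegrable (fun u : ℝ => u ^ (-s) * Real.exp (-(δ * u))) MeasureTheory.volume x y := by
  refine ContinuousOn.intervalIntegrable ?_
  rw [Set.uIcc_of_le hxy]
  refine ContinuousOn.mul ?_ (by fun_prop)
  exact ContinuousOn.rpow_const continuousOn_id fun u hu => Or.inl (hx.trans_le hu.1).ne'

/-- The function comparing `log u` with a power, weighted by `δ e^{-δu}`. -/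
noncomputable def weightedLogMinorant (c δ s u : ℝ) : ℝ :=
  (c - Real.log δ + 1 / s) * (δ * Real.exp (-(δ * u))) -
    δ ^ (1 - s) / s * (u ^ (-s) * Real.exp (-(δ * u)))

theorem intervalIntegrable_weightedLogMinorant {x y : ℝ} (hx : 0 < x) (hxy : x ≤ y) (c s δ : ℝ) :
    IntervalIntegrable (weightedLogMinorant c δ s) MeasureTheory.volume x y :=
  (Continuous.intervalIntegrable (by fun_prop) _ _).sub
    ((intervalIntegrable_rpow_mul_exp hx hxy s δ).const_mul _)

theorem weightedLogMinorant_le {c δ s u : ℝ} (hδ : 0 < δ) (hs : 0 < s) (hu : 0 < u) :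
    weightedLogMinorant c δ s u ≤ (c + Real.log u) * (δ * Real.exp (-(δ * u))) := by
  have h1 := Real.log_le_sub_one_of_pos (show 0 < (δ * u) ^ (-s) by positivity)
  rw [Real.log_rpow (by positivity), Real.log_mul hδ.ne' hu.ne'] at h1
  have h2 : (δ * u) ^ (-s) = δ ^ (-s) * u ^ (-s) := Real.mul_rpow hδ.le hu.le
  have h3 : δ ^ (1 - s) = δ * δ ^ (-s) := by
    rw [sub_eq_add_neg, Real.rpow_add hδ, Real.rpow_one]
  have h4 : -Real.log δ + 1 / s - (δ * u) ^ (-s) / s ≤ Real.log u := by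
    have : (1 - (δ * u) ^ (-s)) / s ≤ Real.log δ + Real.log u := by
      rw [div_le_iff₀ hs]; linarith
    rw [sub_div] at this
    linarith
  unfold weightedLogMinorant
  have h5 := mul_le_mul_of_nonneg_right h4 (show 0 ≤ δ * Real.exp (-(δ * u)) by positivity)
  rw [h2] at h5
  rw [h3]
  calc _ = c * (δ * Real.exp (-(δ * u))) + (-Real.log δ + 1 / s - δ ^ (-s) * u ^ (-s) / s) *
        (δ * Real.exp (-(δ * u))) := by ring
    _ ≤ _ := by linarith

theorem integral_weightedLogMinorant_le {c δ s : ℝ} {n : ℕ} (hδ : 0 < δ) (hs : 0 < s)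
    (hn : 2 ≤ n) :
    ∫ u in Real.log n..Real.log (n + 1 : ℕ), weightedLogMinorant c δ s u ≤
      (Real.log (Real.log (n + 1)) + c) * ((n : ℝ) ^ (-δ) - ((n + 1 : ℕ) : ℝ) ^ (-δ)) := by
  have hn' : (2 : ℝ) ≤ n := by exact_mod_cast hn
  have h0 : 0 < Real.log n := Real.log_pos (by linarith)
  have h1 : Real.log n ≤ Real.log (n + 1 : ℕ) := Real.log_le_log (by linarith) (by push_cast; linarith)
  rw [natCast_rpow_neg_eq_exp (by omega), natCast_rpow_neg_eq_exp (by omega),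
    ← integral_exp_neg_mul, ← intervalIntegral.integral_const_mul]
  refine intervalIntegral.integral_mono_on h1 (intervalIntegrable_weightedLogMinorant h0 h1 _ _ _)
    (Continuous.intervalIntegrable (by fun_prop) _ _) ?_
  intro u hu
  have hu0 : 0 < u := h0.trans_le hu.1
  refine (weightedLogMinorant_le hδ hs hu0).trans ?_
  refine mul_le_mul_of_nonneg_right ?_ (by positivity)
  have : Real.log u ≤ Real.log (Real.log (n + 1 : ℕ)) := Real.log_le_log hu0 hu.2
  push_cast at this
  linarith

theorem integral_rpow_mul_exp_le {x y δ s : ℝ} (hx : 0 < x) (hxy : x ≤ y) (hδ : 0 < δ)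
    (hs1 : s < 1) :
    ∫ u in x..y, u ^ (-s) * Real.exp (-(δ * u)) ≤ δ ^ (s - 1) * Real.Gamma (1 - s) := by
  have h := Real.integral_rpow_mul_exp_neg_mul_Ioi (a := 1 - s) (r := δ) (by linarith) hδ
  have e : (1 - s - 1 : ℝ) = -s := by ring
  have e2 : (1 / δ) ^ (1 - s) = δ ^ (s - 1) := by
    rw [one_div, Real.inv_rpow hδ.le, ← Real.rpow_neg hδ.le]; ring_nf
  rw [e, e2] at h
  rw [← h, intervalIntegral.integral_of_le hxy]
  refine MeasureTheory.setIntegral_mono_set ?_ ?_ ?_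
  · have := integrableOn_rpow_mul_exp_neg_mul_rpow (p := 1) (s := -s) (b := δ) (by linarith)
      one_pos hδ
    simpa using this
  · filter_upwards [MeasureTheory.ae_restrict_mem measurableSet_Ioi] with u hu
    have : 0 < u := hu
    simp only [Pi.zero_apply]
    positivity
  · exact Filter.Eventually.of_forall fun u hu => lt_of_lt_of_le hx hu.1.le

theorem log_zeta_ge_partial {c δ s : ℝ} {n₀ N : ℕ} (h2 : 2 ≤ n₀)
    (h : ∀ n, n₀ ≤ n → Real.log (Real.log (n + 1)) + c ≤ vonMangoldtLogSum n)
    (hδ : 0 < δ) (hs : 0 < s) (hs1 : s < 1) (hN : n₀ ≤ N) :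
    (c - Real.log δ + 1 / s) * ((n₀ : ℝ) ^ (-δ) - (N : ℝ) ^ (-δ)) - Real.Gamma (1 - s) / s ≤
      Real.log (riemannZeta ((1 + δ : ℝ) : ℂ)).re := by
  have hsum : Summable fun n : ℕ => Λ n / ((n : ℝ) ^ (1 + δ) * Real.log n) := by
    refine Summable.of_nonneg_of_le (fun n => ?_) (fun n => ?_)
      (Real.summable_nat_rpow.2 (show -(1 + δ) < -1 by linarith))
    · have := Real.log_natCast_nonneg n
      have := vonMangoldt_nonneg (n := n)
      positivity
    · rw [Real.rpow_neg (by positivity)]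
      rcases Nat.lt_or_ge n 2 with hn | hn
      · have : n = 0 ∨ n = 1 := by omega
        rcases this with rfl | rfl
        · simp; positivity
        · simp
      · have hl : 0 < Real.log n := Real.log_pos (by exact_mod_cast hn)
        rw [mul_comm, ← div_div, div_eq_mul_inv (Λ n / _)]
        exact mul_le_of_le_one_left (by positivity) ((div_le_one hl).2 vonMangoldt_le_log)
  rw [log_riemannZeta_eq (by linarith)]
  have hnn : ∀ n : ℕ, 0 ≤ Λ n / ((n : ℝ) ^ (1 + δ) * Real.log n) := fun n => by
    have := Real.log_natCast_nonneg n
    have := vonMangoldt_nonneg (n := n)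
    positivity
  refine le_trans ?_ (hsum.sum_le_tsum (Ioc 0 N) fun n _ => hnn n)
  have e1 : ∑ n ∈ Ioc 0 N, Λ n / ((n : ℝ) ^ (1 + δ) * Real.log n) =
      ∑ n ∈ Ioc 0 N, Λ n / (n * Real.log n) * (n : ℝ) ^ (-δ) := by
    refine sum_congr rfl fun n hn => ?_
    simp only [mem_Ioc] at hn
    have hn0 : (0 : ℝ) < n := by exact_mod_cast hn.1
    rw [Real.rpow_add hn0, Real.rpow_one, Real.rpow_neg hn0.le]
    field_simp
  rw [e1]
  have hF0 : ∀ n : ℕ, 0 ≤ Λ n / (n * Real.log n) := fun n => by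
    have := Real.log_natCast_nonneg n
    have := vonMangoldt_nonneg (n := n)
    positivity
  have hw : ∀ n : ℕ, 0 < n → ((n + 1 : ℕ) : ℝ) ^ (-δ) ≤ (n : ℝ) ^ (-δ) := fun n hn =>
    Real.rpow_le_rpow_of_nonpos (by exact_mod_cast hn) (by push_cast; linarith) (by linarith)
  refine le_trans ?_ (sum_mul_ge_of_antitone (w := fun n : ℕ => (n : ℝ) ^ (-δ)) hF0 hw hN)
  have e2 : 0 ≤ (∑ n ∈ Ioc 0 N, Λ n / (n * Real.log n)) * (N : ℝ) ^ (-δ) :=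
    mul_nonneg (sum_nonneg fun n _ => hF0 n) (by positivity)
  refine le_trans ?_ (le_add_of_nonneg_right e2)
  have hpos : ∀ k, n₀ ≤ k → 0 < Real.log (k : ℝ) := fun k hk =>
    Real.log_pos (by exact_mod_cast (by omega : 1 < k))
  have hmono : ∀ i j : ℕ, n₀ ≤ i → i ≤ j → Real.log (i : ℝ) ≤ Real.log (j : ℝ) := fun i j hi hij =>
    Real.log_le_log (by exact_mod_cast (by omega : 0 < i)) (by exact_mod_cast hij)
  have e3 : ∑ n ∈ Ico n₀ N, ∫ u in Real.log n..Real.log (n + 1 : ℕ), weightedLogMinorant c δ s u =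
      ∫ u in Real.log n₀..Real.log N, weightedLogMinorant c δ s u :=
    intervalIntegral.sum_integral_adjacent_intervals_Ico (a := fun n : ℕ => Real.log n) hN
      fun k hk => intervalIntegrable_weightedLogMinorant (hpos k hk.1)
        (hmono _ _ hk.1 (Nat.le_succ k)) _ _ _
  have e4 : ∑ n ∈ Ico n₀ N, ∫ u in Real.log n..Real.log (n + 1 : ℕ),
      weightedLogMinorant c δ s u ≤ ∑ n ∈ Ico n₀ N, (∑ k ∈ Ioc 0 n, Λ k / (k * Real.log k)) *
        ((n : ℝ) ^ (-δ) - ((n + 1 : ℕ) : ℝ) ^ (-δ)) := by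
    refine sum_le_sum fun n hn => ?_
    simp only [mem_Ico] at hn
    refine (integral_weightedLogMinorant_le hδ hs (by omega)).trans ?_
    exact mul_le_mul_of_nonneg_right (h n hn.1) (sub_nonneg.2 (hw n (by omega)))
  refine le_trans ?_ e4
  rw [e3]
  have hx := hpos n₀ le_rfl
  have hxy := hmono n₀ N le_rfl hN
  unfold weightedLogMinorant
  rw [intervalIntegral.integral_sub (Continuous.intervalIntegrable (by fun_prop) _ _)
      ((intervalIntegrable_rpow_mul_exp hx hxy s δ).const_mul _),
    intervalIntegral.integral_const_mul (c - Real.log δ + 1 / s), integral_exp_neg_mul,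
    intervalIntegral.integral_const_mul (δ ^ (1 - s) / s), natCast_rpow_neg_eq_exp (by omega), natCast_rpow_neg_eq_exp (by omega)]
  have e5 := mul_le_mul_of_nonneg_left (integral_rpow_mul_exp_le hx hxy hδ hs1)
    (show 0 ≤ δ ^ (1 - s) / s by positivity)
  have e6 : δ ^ (1 - s) / s * (δ ^ (s - 1) * Real.Gamma (1 - s)) = Real.Gamma (1 - s) / s := by
    have : δ ^ (1 - s) * δ ^ (s - 1) = 1 := by
      rw [← Real.rpow_add hδ]; simp
    calc _ = (δ ^ (1 - s) * δ ^ (s - 1)) * (Real.Gamma (1 - s) / s) := by ring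
      _ = _ := by rw [this, one_mul]
  rw [e6] at e5
  linarith

theorem log_zeta_ge {c δ s : ℝ} {n₀ : ℕ} (h2 : 2 ≤ n₀)
    (h : ∀ n, n₀ ≤ n → Real.log (Real.log (n + 1)) + c ≤ vonMangoldtLogSum n)
    (hδ : 0 < δ) (hs : 0 < s) (hs1 : s < 1) :
    (c - Real.log δ + 1 / s) * (n₀ : ℝ) ^ (-δ) - Real.Gamma (1 - s) / s ≤
      Real.log (riemannZeta ((1 + δ : ℝ) : ℂ)).re := by
  have h1 : Filter.Tendsto (fun N : ℕ => (c - Real.log δ + 1 / s) *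
      ((n₀ : ℝ) ^ (-δ) - (N : ℝ) ^ (-δ)) - Real.Gamma (1 - s) / s) Filter.atTop
      (nhds ((c - Real.log δ + 1 / s) * ((n₀ : ℝ) ^ (-δ) - 0) - Real.Gamma (1 - s) / s)) :=
    (((tendsto_rpow_neg_atTop hδ).comp tendsto_natCast_atTop_atTop).const_sub _ |>.const_mul _
      |>.sub_const _)
  rw [sub_zero] at h1
  refine le_of_tendsto h1 ?_
  filter_upwards [Filter.eventually_ge_atTop n₀] with N hN
  exact log_zeta_ge_partial h2 h hδ hs hs1 hN

theorem le_gamma_quotient {c s : ℝ} {n₀ : ℕ} (h2 : 2 ≤ n₀)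
    (h : ∀ n, n₀ ≤ n → Real.log (Real.log (n + 1)) + c ≤ vonMangoldtLogSum n)
    (hs : 0 < s) (hs1 : s < 1) : c ≤ (Real.Gamma (1 - s) - 1) / s := by
  have hl : Filter.Tendsto (fun δ : ℝ => Real.log (riemannZeta ((1 + δ : ℝ) : ℂ)).re +
      Real.log δ) (nhdsWithin 0 (Set.Ioi 0)) (nhds 0) := by
    have h1 := (Asymptotics.isLittleO_one_iff ℝ).1 log_riemannZeta_add_log_sub_isLittleO_ofReal
    have h3 : Filter.Tendsto (fun δ : ℝ => 1 + δ) (nhdsWithin 0 (Set.Ioi 0))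
        (nhdsWithin 1 (Set.Ioi 1)) := by
      refine tendsto_nhdsWithin_iff.2 ⟨?_, ?_⟩
      · have : Filter.Tendsto (fun δ : ℝ => 1 + δ) (nhds 0) (nhds (1 + 0)) :=
          (continuous_const.add continuous_id).tendsto 0
        rw [add_zero] at this
        exact this.mono_left nhdsWithin_le_nhds
      · filter_upwards [self_mem_nhdsWithin] with δ hδ
        have : (0 : ℝ) < δ := hδ
        simp only [Set.mem_Ioi]
        linarith
    refine (h1.comp h3).congr fun δ => ?_
    simp
  have hm : Filter.Tendsto (fun δ : ℝ => δ * Real.log δ) (nhdsWithin 0 (Set.Ioi 0)) (nhds 0) := by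
    have := Real.continuous_mul_log.tendsto 0
    simp only [zero_mul] at this
    exact this.mono_left nhdsWithin_le_nhds
  have hid : Filter.Tendsto (fun δ : ℝ => δ) (nhdsWithin 0 (Set.Ioi 0)) (nhds 0) :=
    Filter.tendsto_id.mono_left nhdsWithin_le_nhds
  have hL : Filter.Tendsto (fun δ : ℝ => Real.log (riemannZeta ((1 + δ : ℝ) : ℂ)).re +
      Real.log δ + |c + 1 / s| * (Real.log n₀ * δ) - Real.log n₀ * (δ * Real.log δ))
      (nhdsWithin 0 (Set.Ioi 0)) (nhds (0 + |c + 1 / s| * (Real.log n₀ * 0) - Real.log n₀ * 0)) :=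
    (hl.add ((hid.const_mul _).const_mul _)).sub (hm.const_mul _)
  simp only [mul_zero, add_zero, sub_zero] at hL
  have key : c + 1 / s - Real.Gamma (1 - s) / s ≤ 0 := by
    refine ge_of_tendsto hL ?_
    have hlt : ∀ᶠ δ : ℝ in nhdsWithin 0 (Set.Ioi 0), δ < 1 :=
      nhdsWithin_le_nhds (gt_mem_nhds one_pos)
    filter_upwards [self_mem_nhdsWithin, hlt] with δ hδ hδ1
    have hδ0 : (0 : ℝ) < δ := hδ
    have h1 := log_zeta_ge h2 h hδ0 hs hs1
    have hn0 : 0 ≤ Real.log n₀ := Real.log_natCast_nonneg _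
    have hw1 : (n₀ : ℝ) ^ (-δ) ≤ 1 := by
      rw [natCast_rpow_neg_eq_exp (by omega)]
      exact Real.exp_le_one_iff.2 (by nlinarith)
    have hw2 : 1 - Real.log n₀ * δ ≤ (n₀ : ℝ) ^ (-δ) := by
      rw [natCast_rpow_neg_eq_exp (by omega)]
      have := Real.add_one_le_exp (-(δ * Real.log n₀))
      linarith
    have hlog : Real.log δ ≤ 0 := Real.log_nonpos hδ0.le hδ1.le
    generalize (n₀ : ℝ) ^ (-δ) = w at *
    have e1 : (c + 1 / s) * (1 - w) ≤ |c + 1 / s| * (Real.log n₀ * δ) :=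
      mul_le_mul (le_abs_self _) (by linarith) (by linarith) (abs_nonneg _)
    have e2 : -Real.log δ * (1 - w) ≤ -Real.log δ * (Real.log n₀ * δ) :=
      mul_le_mul_of_nonneg_left (by linarith) (by linarith)
    have e3 : (c - Real.log δ + 1 / s) * w = (c + 1 / s) - Real.log δ - (c + 1 / s) * (1 - w)
        - -Real.log δ * (1 - w) := by ring
    rw [e3] at h1
    have e4 : -Real.log δ * (Real.log n₀ * δ) = - (Real.log n₀ * (δ * Real.log δ)) := by ring
    rw [e4] at e2
    linarith
  rw [sub_div]
  linarith

/-- A Mertens-type limit comparison: a lower bound `log log (n + 1) + c` for the partial sums of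
`Λ(n)/(n log n)` forces `c ≤ γ`. -/
theorem le_eulerMascheroniConstant {c : ℝ} {n₀ : ℕ} (h2 : 2 ≤ n₀)
    (h : ∀ n, n₀ ≤ n → Real.log (Real.log (n + 1)) + c ≤ vonMangoldtLogSum n) :
    c ≤ Real.eulerMascheroniConstant := by
  have h1 : HasDerivAt (fun s : ℝ => Real.Gamma (1 - s)) (Real.eulerMascheroniConstant) 0 := by
    have hg : HasDerivAt (fun s : ℝ => 1 - s) (-1) 0 := by
      simpa using (hasDerivAt_id (0 : ℝ)).const_sub 1
    have h3 : HasDerivAt Real.Gamma (-Real.eulerMascheroniConstant) (1 - 0) := by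
      rw [sub_zero]; exact Real.hasDerivAt_Gamma_one
    simpa [Function.comp_def] using h3.comp 0 hg
  have h4 := h1.hasDerivWithinAt (s := Set.Ioi 0)
  rw [hasDerivWithinAt_iff_tendsto_slope' (by simp)] at h4
  refine ge_of_tendsto h4 ?_
  have hlt : ∀ᶠ s : ℝ in nhdsWithin 0 (Set.Ioi 0), s < 1 :=
    nhdsWithin_le_nhds (gt_mem_nhds one_pos)
  filter_upwards [self_mem_nhdsWithin, hlt] with s hs hs1
  rw [slope_def_field]
  simpa using le_gamma_quotient h2 h hs hs1
end

section
open ArithmeticFunction Finset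

theorem vonMangoldtLogSum_le {N : ℕ} (hN : 2 ≤ N) :
    vonMangoldtLogSum N ≤ Real.log (Real.log (N + 1)) + Real.eulerMascheroniConstant +
      (0.9219 + (Real.log N ^ 2 + Real.log N + 35) / N) / Real.log (N + 1) := by
  have hN0 : (2 : ℝ) ≤ N := by exact_mod_cast hN
  have hc := le_eulerMascheroniConstant (c := 1 + (vonMangoldtLogSum N -
    Real.log (Real.log (N + 1)) - (vonMangoldtSum N + 1) / Real.log (N + 1))) hN
    (fun K hK => by
      have hK0 : (2 : ℝ) ≤ K := by exact_mod_cast hN.trans hK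
      have h1 := monotone_vonMangoldtLogSum_sub (by omega : 1 ≤ N) hK
      have h2 := vonMangoldtSum_lower (show 1 ≤ K by omega)
      have h3 : 0 < Real.log ((K : ℝ) + 1) := Real.log_pos (by linarith)
      have h4 : 1 ≤ (vonMangoldtSum K + 1) / Real.log (K + 1) := by
        rw [one_le_div h3]; linarith
      linarith)
  have h1 := vonMangoldtSum_upper hN
  have h3 : 0 < Real.log ((N : ℝ) + 1) := Real.log_pos (by linarith)
  have h4 : Real.log N ≤ Real.log ((N : ℝ) + 1) := Real.log_le_log (by linarith) (by linarith)
  have h5 : (vonMangoldtSum N + 1) / Real.log (N + 1) ≤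
      1 + (0.9219 + (Real.log N ^ 2 + Real.log N + 35) / N) / Real.log (N + 1) := by
    rw [div_le_iff₀ h3, add_mul, div_mul_cancel₀ _ h3.ne']
    linarith
  linarith

theorem neg_log_one_sub_le {x : ℝ} (h0 : 0 ≤ x) (h1 : x < 1) (K : ℕ) :
    -Real.log (1 - x) ≤ ∑ k ∈ range K, x ^ (k + 1) / (k + 1) +
      x ^ (K + 1) / ((K + 1) * (1 - x)) := by
  have hs := Real.hasSum_pow_div_log_of_abs_lt_one (x := x) (by rwa [abs_of_nonneg h0])
  have ht := (hasSum_nat_add_iff' K).2 hs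
  have hg := (hasSum_geometric_of_lt_one h0 h1).mul_left (x ^ (K + 1) / (K + 1))
  have := hasSum_le (fun n => ?_) ht hg
  · rw [← div_eq_mul_inv, div_div] at this
    linarith
  · have e : x ^ (K + 1) / ((K : ℝ) + 1) * x ^ n = x ^ (n + K + 1) / (K + 1) := by
      rw [div_mul_eq_mul_div, ← pow_add]; congr 2; ring
    rw [e]
    push_cast
    exact div_le_div_of_nonneg_left (by positivity) (by positivity)
      (by linarith [show (0 : ℝ) ≤ n by positivity])

theorem sum_primes_le_vonMangoldtLogSum (N : ℕ) :
    ∑ p ∈ (N + 1).primesBelow, ∑ k ∈ range (Nat.log p N), (1 / (p : ℝ)) ^ (k + 1) / (k + 1) ≤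
      vonMangoldtLogSum N := by
  rw [sum_sigma']
  have hinj : Set.InjOn (fun x : (_ : ℕ) × ℕ => x.1 ^ (x.2 + 1))
      ((N + 1).primesBelow.sigma fun p => range (Nat.log p N)) := by
    rintro ⟨p, k⟩ hx ⟨r, l⟩ hy hxy
    simp only [coe_sigma, Set.mem_sigma_iff, mem_coe, Nat.mem_primesBelow] at hx hy
    have := Nat.Prime.pow_inj hx.1.2 hy.1.2 hxy
    obtain ⟨rfl, rfl⟩ := this
    rfl
  have hterm : ∀ x ∈ (N + 1).primesBelow.sigma fun p => range (Nat.log p N),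
      (1 / (x.1 : ℝ)) ^ (x.2 + 1) / (x.2 + 1) =
        Λ (x.1 ^ (x.2 + 1)) / (((x.1 ^ (x.2 + 1) : ℕ) : ℝ) *
          Real.log ((x.1 ^ (x.2 + 1) : ℕ) : ℝ)) := by
    rintro ⟨p, k⟩ hx
    simp only [mem_sigma, Nat.mem_primesBelow] at hx
    have hp := hx.1.2
    have hp1 : (1 : ℝ) < p := by exact_mod_cast hp.one_lt
    have hl : 0 < Real.log p := Real.log_pos hp1
    simp only
    rw [vonMangoldt_apply_pow (by omega), vonMangoldt_apply_prime hp]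
    push_cast
    rw [Real.log_pow]
    push_cast
    rw [one_div, inv_pow]
    field_simp
  rw [sum_congr rfl hterm, ← sum_image (f := fun n : ℕ => Λ n / ((n : ℝ) * Real.log n)) hinj,
    vonMangoldtLogSum]
  refine sum_le_sum_of_subset_of_nonneg ?_ ?_
  · intro n hn
    simp only [mem_image, mem_sigma, Nat.mem_primesBelow, mem_range] at hn
    obtain ⟨⟨p, k⟩, ⟨⟨h1, h2⟩, h3⟩, rfl⟩ := hn
    simp only at h1 h2 h3 ⊢
    have : N ≠ 0 := by rintro rfl; simp at h3
    exact mem_Ioc.2 ⟨pow_pos h2.pos _, Nat.pow_le_of_le_log this h3⟩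
  · intro n _ _
    have := Real.log_natCast_nonneg n
    have := vonMangoldt_nonneg (n := n)
    positivity

theorem tail_le {p N : ℕ} (hp : p.Prime) (hpN : p ≤ N) :
    -Real.log (1 - 1 / (p : ℝ)) - ∑ k ∈ range (Nat.log p N), (1 / (p : ℝ)) ^ (k + 1) / (k + 1) ≤
      min (1 / ((N : ℝ) + 1)) (1 / 2 * (1 / ((p : ℝ) - 1) - 1 / p)) := by
  have hp2 : (2 : ℝ) ≤ p := by exact_mod_cast hp.two_le
  have h1 := neg_log_one_sub_le (x := 1 / (p : ℝ)) (by positivity)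
    (by rw [div_lt_one (by linarith)]; linarith) (Nat.log p N)
  have hK : 1 ≤ Nat.log p N := Nat.log_pos hp.one_lt hpN
  have hK' : (1 : ℝ) ≤ Nat.log p N := by exact_mod_cast hK
  have hpow : N + 1 ≤ p ^ (Nat.log p N + 1) := Nat.lt_pow_succ_log_self hp.one_lt N
  have hpow' : (N : ℝ) + 1 ≤ (p : ℝ) ^ (Nat.log p N + 1) := by exact_mod_cast hpow
  have hpow2 : (p : ℝ) ^ 2 ≤ (p : ℝ) ^ (Nat.log p N + 1) :=
    pow_le_pow_right₀ (by linarith) (by omega)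
  have hN0 : (0 : ℝ) < (N : ℝ) + 1 := by positivity
  have h2 : (1 / (p : ℝ)) ^ (Nat.log p N + 1) / (((Nat.log p N : ℕ) + 1) * (1 - 1 / (p : ℝ))) ≤
      (1 / (p : ℝ) ^ (Nat.log p N + 1)) * (1 / 2 * (p / (p - 1))) := by
    rw [one_div_pow, div_eq_mul_one_div]
    refine mul_le_mul_of_nonneg_left ?_ (by positivity)
    have : 1 - 1 / (p : ℝ) = (p - 1) / p := by field_simp
    have hp1 : (0 : ℝ) < p - 1 := by linarith
    rw [this]
    rw [one_div, mul_inv, inv_div]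
    refine mul_le_mul_of_nonneg_right ?_ (by positivity)
    rw [one_div]
    exact inv_anti₀ (by norm_num) (by linarith)
  have hq : (p : ℝ) / (p - 1) ≤ 2 := by
    rw [div_le_iff₀ (by linarith)]; linarith
  have hq0 : 0 ≤ (p : ℝ) / (p - 1) := div_nonneg (by linarith) (by linarith)
  refine le_trans (by linarith [h1]) (le_trans h2 (le_min ?_ ?_))
  · calc _ ≤ 1 / (p : ℝ) ^ (Nat.log p N + 1) * 1 :=
          mul_le_mul_of_nonneg_left (by linarith) (by positivity)
      _ ≤ _ := by rw [mul_one]; exact one_div_le_one_div_of_le hN0 hpow'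
  · calc _ ≤ 1 / (p : ℝ) ^ 2 * (1 / 2 * (p / (p - 1))) :=
          mul_le_mul_of_nonneg_right (one_div_le_one_div_of_le (by positivity) hpow2)
            (by positivity)
      _ = _ := by
          have hp1 : (p : ℝ) - 1 ≠ 0 := by linarith
          field_simp
          ring

theorem neg_log_prod_le {N s : ℕ} (hs : 1 ≤ s) :
    -Real.log (∏ r ∈ (N + 1).primesBelow, (1 - 1 / (r : ℝ))) ≤
      vonMangoldtLogSum N + (s / ((N : ℝ) + 1) + 1 / (2 * s)) := by
  have hne : ∀ r ∈ (N + 1).primesBelow, (1 - 1 / (r : ℝ)) ≠ 0 := by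
    intro r hr
    have : (1 : ℝ) < r := by exact_mod_cast (Nat.mem_primesBelow.1 hr).2.one_lt
    have : 1 / (r : ℝ) < 1 := by rw [div_lt_one (by linarith)]; exact this
    linarith
  rw [Real.log_prod hne, ← sum_neg_distrib]
  have h1 : ∑ r ∈ (N + 1).primesBelow, (-Real.log (1 - 1 / (r : ℝ)) -
      ∑ k ∈ range (Nat.log r N), (1 / (r : ℝ)) ^ (k + 1) / (k + 1)) ≤
      s / ((N : ℝ) + 1) + 1 / (2 * s) := by
    have hB (r : ℕ) (hr : r ∈ (N + 1).primesBelow) : -Real.log (1 - 1 / (r : ℝ)) -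
      ∑ k ∈ range (Nat.log r N), (1 / (r : ℝ)) ^ (k + 1) / (k + 1) ≤
        min (1 / ((N : ℝ) + 1)) (1 / 2 * (1 / ((r : ℝ) - 1) - 1 / r)) :=
      tail_le (Nat.mem_primesBelow.1 hr).2 (Nat.lt_succ_iff.1 (Nat.mem_primesBelow.1 hr).1)
    refine (sum_le_sum hB).trans ?_
    rw [← sum_filter_add_sum_filter_not _ (fun r => r ≤ s)]
    refine add_le_add ?_ ?_
    · refine (sum_le_sum (fun i _ => min_le_left _ _)).trans ?_
      rw [sum_const, nsmul_eq_mul, mul_one_div]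
      have : #{x ∈ (N + 1).primesBelow | x ≤ s} ≤ #(Ioc 0 s) := card_le_card fun r hr => by
        simp only [mem_filter, Nat.mem_primesBelow] at hr
        exact mem_Ioc.2 ⟨hr.1.2.pos, hr.2⟩
      rw [Nat.card_Ioc, Nat.sub_zero] at this
      have h' : (#{x ∈ (N + 1).primesBelow | x ≤ s} : ℝ) ≤ s := by exact_mod_cast this
      gcongr
    · have htel : ∀ m, s ≤ m → ∑ r ∈ Ico s m, 1 / 2 * (1 / ((r + 1 : ℕ) - 1 : ℝ) -
          1 / ((r + 1 : ℕ) : ℝ)) = 1 / 2 * (1 / s - 1 / m) := by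
        intro m hm
        induction m, hm using Nat.le_induction with
        | base => simp
        | succ m hm ih =>
          rw [sum_Ico_succ_top hm, ih]
          push_cast
          ring
      have hsub : {x ∈ (N + 1).primesBelow | ¬ x ≤ s} ⊆
          (Ico s (max s N)).image (fun r => r + 1) := by
        intro r hr
        simp only [mem_filter, Nat.mem_primesBelow] at hr
        simp only [mem_image, mem_Ico]
        exact ⟨r - 1, by omega, by omega⟩
      refine (sum_le_sum (fun i _ => min_le_right _ _)).trans ?_
      refine (sum_le_sum_of_subset_of_nonneg hsub ?_).trans ?_
      · intro r hr _
        simp only [mem_image, mem_Ico] at hr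
        obtain ⟨a, ha, rfl⟩ := hr
        have : (0 : ℝ) < a := by exact_mod_cast (by omega : 0 < a)
        have : 1 / ((a + 1 : ℕ) : ℝ) ≤ 1 / (((a + 1 : ℕ) : ℝ) - 1) :=
          one_div_le_one_div_of_le (by push_cast; linarith) (by linarith)
        linarith
      · rw [sum_image (by intro a _ b _ h; simpa using h), htel _ (le_max_left _ _)]
        have : (0 : ℝ) ≤ 1 / ((max s N : ℕ) : ℝ) := by positivity
        have e : 1 / (2 * (s : ℝ)) = 1 / 2 * (1 / s) := by ring
        rw [e]
        linarith
  rw [sum_sub_distrib] at h1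
  have := sum_primes_le_vonMangoldtLogSum N
  linarith

theorem neg_log_prod_le_of_large {q : ℕ} (hq : 32768 ≤ q) :
    -Real.log (∏ r ∈ q.primesBelow, (1 - 1 / (r : ℝ))) ≤
      Real.eulerMascheroniConstant + Real.log (Real.log (3 * q)) := by
  obtain ⟨N, rfl⟩ : ∃ N, q = N + 1 := ⟨q - 1, by omega⟩
  have hq' : (32768 : ℝ) ≤ (N : ℝ) + 1 := by exact_mod_cast hq
  obtain ⟨s, hs, hs1, hs2⟩ : ∃ s : ℕ, 181 ≤ s ∧ (s : ℝ) * s ≤ (N : ℝ) + 1 ∧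
      (N : ℝ) + 1 < (s + 1) * (s + 1) :=
    ⟨Nat.sqrt (N + 1), Nat.le_sqrt.2 (by omega), by exact_mod_cast Nat.sqrt_le (N + 1),
      by exact_mod_cast Nat.lt_succ_sqrt (N + 1)⟩
  have hs' : (181 : ℝ) ≤ s := by exact_mod_cast hs
  have h1 := neg_log_prod_le (N := N) (s := s) (by omega)
  have h2 := vonMangoldtLogSum_le (N := N) (by omega)
  clear hq
  push_cast
  have hl2 := Real.log_two_gt_d9
  have hl2' := Real.log_two_lt_d9
  have hl3 := Real.log_three_gt_d9
  have hL : (10.39 : ℝ) ≤ Real.log ((N : ℝ) + 1) := by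
    have : Real.log ((2 : ℝ) ^ 15) ≤ Real.log ((N : ℝ) + 1) :=
      Real.log_le_log (by norm_num) (by linarith)
    rw [Real.log_pow] at this
    push_cast at this
    linarith
  have h182 : Real.log 182 ≤ 5.25 := by
    have h : Real.log ((182 : ℝ) ^ 2) ≤ Real.log ((2 : ℝ) ^ 15 * (1 + 356 / 32768)) :=
      Real.log_le_log (by norm_num) (by norm_num)
    have h' := Real.log_le_sub_one_of_pos (show (0 : ℝ) < 1 + 356 / 32768 by norm_num)
    rw [Real.log_mul (by norm_num) (by norm_num), Real.log_pow, Real.log_pow] at h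
    push_cast at h
    linarith
  have hLu : Real.log ((N : ℝ) + 1) ≤ 10.5 / 182 * (s + 1) := by
    have h3 : Real.log ((N : ℝ) + 1) ≤ Real.log (((s : ℝ) + 1) ^ 2) :=
      Real.log_le_log (by linarith) (by nlinarith)
    have h4 := Real.log_le_sub_one_of_pos (show (0 : ℝ) < (s + 1) / 182 by positivity)
    rw [Real.log_div (by positivity) (by norm_num)] at h4
    rw [Real.log_pow] at h3
    push_cast at h3
    linarith
  have hlN : Real.log N ≤ Real.log ((N : ℝ) + 1) := Real.log_le_log (by linarith) (by linarith)
  have hlN0 : 0 ≤ Real.log N := Real.log_natCast_nonneg N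
  have h3 : Real.log (3 * ((N : ℝ) + 1)) = Real.log 3 + Real.log ((N : ℝ) + 1) :=
    Real.log_mul (by norm_num) (by positivity)
  rw [h3]
  set L := Real.log ((N : ℝ) + 1) with hLdef
  have hL0 : 0 < L := by linarith
  have h4 : Real.log L + 2 * (Real.log 3 / L) / (Real.log 3 / L + 2) ≤
      Real.log (Real.log 3 + L) := by
    have h5 := Real.le_log_one_add_of_nonneg (x := Real.log 3 / L)
      (div_nonneg (by linarith) hL0.le)
    have h6 : Real.log 3 + L = L * (1 + Real.log 3 / L) := by field_simp; ring
    rw [h6, Real.log_mul hL0.ne' (by have := div_nonneg (show 0 ≤ Real.log 3 by linarith) hL0.le; linarith)]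
    linarith
  have h7 : 1.04 / L ≤ 2 * (Real.log 3 / L) / (Real.log 3 / L + 2) := by
    have e : 2 * (Real.log 3 / L) / (Real.log 3 / L + 2) =
        (2 * L * Real.log 3 / (Real.log 3 + 2 * L)) / L := by
      have : Real.log 3 + 2 * L ≠ 0 := by linarith
      field_simp
    rw [e]
    refine div_le_div_of_nonneg_right ?_ hL0.le
    rw [le_div_iff₀ (by linarith)]
    nlinarith
  have hN0 : (0 : ℝ) < N := by linarith
  have h8 : (Real.log N ^ 2 + Real.log N + 35) / N ≤ 0.006 := by
    rw [div_le_iff₀ hN0]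
    have : Real.log N ≤ 10.5 / 182 * (s + 1) := by linarith
    have : Real.log N ^ 2 ≤ (10.5 / 182 * (s + 1)) ^ 2 := pow_le_pow_left₀ hlN0 this 2
    nlinarith
  have h9 : s / ((N : ℝ) + 1) + 1 / (2 * s) ≤ 1.5 / s := by
    have : s / ((N : ℝ) + 1) ≤ 1 / s := by
      rw [div_le_div_iff₀ (by linarith) (by linarith)]; linarith
    have e : 1.5 / (s : ℝ) = 1 / s + 1 / (2 * s) := by
      field_simp; norm_num
    linarith
  have h10 : 1.5 / (s : ℝ) ≤ 0.0875 / L := by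
    rw [div_le_div_iff₀ (by linarith) hL0]
    nlinarith
  have h11 : (0.9219 + (Real.log N ^ 2 + Real.log N + 35) / N) / L ≤ 0.9279 / L :=
    div_le_div_of_nonneg_right (by linarith) hL0.le
  have h12 : 0.9279 / L + 0.0875 / L ≤ 1.04 / L := by
    rw [← add_div]; exact div_le_div_of_nonneg_right (by norm_num) hL0.le
  linarith

end

section
open Finset

/-- A test that every prime `n ≥ 17` passes; the last modulus is the product of the primes
from 17 to 181. -/
def primeCandidate (n : ℕ) : Bool :=
  Nat.beq (Nat.gcd 30030 n) 1 &&
    (Nat.ble n 288 || Nat.beq (Nat.gcd 179731811282236090000673129459663263612238345999478876305678041944143 n) 1)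

/-- The product of the candidates in `[n, n + 2 ^ d)`. -/
def candidateNum : ℕ → ℕ → ℕ
  | 0, n => bif primeCandidate n then n else 1
  | d + 1, n => Nat.mul (candidateNum d n) (candidateNum d (Nat.add n (Nat.pow 2 d)))

/-- The product of `c - 1` over the candidates `c` in `[n, n + 2 ^ d)`. -/
def candidateDen : ℕ → ℕ → ℕ
  | 0, n => bif primeCandidate n then Nat.sub n 1 else 1
  | d + 1, n => Nat.mul (candidateDen d n) (candidateDen d (Nat.add n (Nat.pow 2 d)))

/-- The product of the candidates in `[16, 16 * 2 ^ j)`. -/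
def cumulativeNum : ℕ → ℕ
  | 0 => 1
  | j + 1 => Nat.mul (cumulativeNum j) (candidateNum (j + 4) (2 ^ (j + 4)))

/-- The product of `c - 1` over the candidates `c` in `[16, 16 * 2 ^ j)`. -/
def cumulativeDen : ℕ → ℕ
  | 0 => 1
  | j + 1 => Nat.mul (cumulativeDen j) (candidateDen (j + 4) (2 ^ (j + 4)))

theorem primeCandidate_of_prime {p : ℕ} (hp : p.Prime) (h : 17 ≤ p) : primeCandidate p = true := by
  have h1 : Nat.gcd 30030 p = 1 :=
    Nat.Coprime.coprime_dvd_left (by decide) (hp.coprime_factorial_of_lt (n := 13) (by omega)).symm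
  unfold primeCandidate
  rw [h1]
  rcases Nat.lt_or_ge p 289 with h2 | h2
  · have : Nat.ble p 288 = true := Nat.ble_eq_true_of_le (by omega)
    rw [this]
    rfl
  · have h3 : Nat.gcd 179731811282236090000673129459663263612238345999478876305678041944143 p = 1 :=
      Nat.Coprime.coprime_dvd_left (by decide +kernel)
        (hp.coprime_factorial_of_lt (n := 181) (by omega)).symm
    rw [h3]
    simp

theorem cumulative_check : ∀ j < 11, 30030 * cumulativeNum (j + 1) * 40000000 ≤
    5760 * cumulativeDen (j + 1) * (7 * (10986122 + (j + 4) * 6931471)) := by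
  decide +kernel

theorem one_sub_one_div_prime_mem {r : ℕ} (hr : r.Prime) :
    0 < 1 - 1 / (r : ℝ) ∧ 1 - 1 / (r : ℝ) ≤ 1 := by
  have h1 : (1 : ℝ) < r := by exact_mod_cast hr.one_lt
  have h2 : 1 / (r : ℝ) < 1 := by rw [div_lt_one (by linarith)]; exact h1
  exact ⟨by linarith, by linarith [show (0 : ℝ) ≤ 1 / r by positivity]⟩

/-- The product of `1 - 1 / p` over the primes in `[a, b)`. -/
noncomputable def primeProd (a b : ℕ) : ℝ := ∏ p ∈ Ico a b with p.Prime, (1 - 1 / (p : ℝ))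

theorem primeProd_mul {a b c : ℕ} (hab : a ≤ b) (hbc : b ≤ c) :
    primeProd a b * primeProd b c = primeProd a c := by
  unfold primeProd
  rw [← prod_union, ← filter_union, Ico_union_Ico_eq_Ico hab hbc]
  exact disjoint_filter_filter (Ico_disjoint_Ico_consecutive a b c)

theorem primeProd_pos (a b : ℕ) : 0 < primeProd a b :=
  prod_pos fun _ hr => (one_sub_one_div_prime_mem (mem_filter.1 hr).2).1

theorem primeProd_le_one (a b : ℕ) : primeProd a b ≤ 1 :=
  prod_le_one (fun _ hr => (one_sub_one_div_prime_mem (mem_filter.1 hr).2).1.le)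
    fun _ hr => (one_sub_one_div_prime_mem (mem_filter.1 hr).2).2

theorem primeProd_zero (q : ℕ) : primeProd 0 q = ∏ r ∈ q.primesBelow, (1 - 1 / (r : ℝ)) := by
  unfold primeProd Nat.primesBelow
  rw [range_eq_Ico]

theorem candidateDen_le (d n : ℕ) (hn : 17 ≤ n + 1) :
    (candidateDen d n : ℝ) ≤ candidateNum d n * primeProd n (n + 2 ^ d) := by
  induction d generalizing n with
  | zero =>
    have hn0 : (1 : ℝ) < n := by exact_mod_cast (by omega : 1 < n)
    have e : Ico n (n + 2 ^ 0) = {n} := by simp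
    unfold primeProd
    rw [e, filter_singleton]
    by_cases hp : n.Prime
    · have h17 : 17 ≤ n := by
        rcases Nat.lt_or_ge 16 n with h | h
        · omega
        · have : n = 16 := by omega
          subst this
          norm_num at hp
      rw [if_pos hp, prod_singleton, candidateDen, candidateNum, primeCandidate_of_prime hp h17]
      simp only [cond_true, Nat.sub_eq]
      rw [Nat.cast_sub (by omega)]
      push_cast
      refine le_of_eq ?_
      field_simp
    · rw [if_neg hp, prod_empty, mul_one, candidateDen, candidateNum]
      cases primeCandidate n
      · simp
      · simp
  | succ d ih =>
    have hd : 0 < 2 ^ d := Nat.two_pow_pos d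
    have h1 := ih n hn
    have h2 := ih (n + 2 ^ d) (by omega)
    have e : n + 2 ^ d + 2 ^ d = n + 2 ^ (d + 1) := by ring
    rw [e] at h2
    rw [← primeProd_mul (show n ≤ n + 2 ^ d by omega) (show n + 2 ^ d ≤ n + 2 ^ (d + 1) by omega)]
    have e1 : candidateDen (d + 1) n = candidateDen d n * candidateDen d (n + 2 ^ d) := rfl
    have e2 : candidateNum (d + 1) n = candidateNum d n * candidateNum d (n + 2 ^ d) := rfl
    rw [e1, e2]
    push_cast
    calc (candidateDen d n : ℝ) * candidateDen d (n + 2 ^ d) ≤ _ :=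
          mul_le_mul h1 h2 (by positivity) ((Nat.cast_nonneg _).trans h1)
      _ = _ := by ring

theorem cumulativeDen_le (j : ℕ) :
    (cumulativeDen j : ℝ) ≤ cumulativeNum j * primeProd 16 (2 ^ (j + 4)) := by
  induction j with
  | zero => simp [cumulativeDen, cumulativeNum, primeProd]
  | succ j ih =>
    have h16 : 16 ≤ 2 ^ (j + 4) := by
      have := Nat.one_le_two_pow (n := j)
      rw [pow_add]; omega
    have h2 := candidateDen_le (j + 4) (2 ^ (j + 4)) (by omega)
    have e : 2 ^ (j + 4) + 2 ^ (j + 4) = 2 ^ (j + 1 + 4) := by ring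
    rw [e] at h2
    rw [← primeProd_mul h16 (show 2 ^ (j + 4) ≤ 2 ^ (j + 1 + 4) by omega)]
    have e1 : cumulativeDen (j + 1) =
      cumulativeDen j * candidateDen (j + 4) (2 ^ (j + 4)) := rfl
    have e2 : cumulativeNum (j + 1) =
      cumulativeNum j * candidateNum (j + 4) (2 ^ (j + 4)) := rfl
    rw [e1, e2]
    push_cast
    calc (cumulativeDen j : ℝ) * candidateDen (j + 4) (2 ^ (j + 4)) ≤ _ :=
          mul_le_mul ih h2 (by positivity) ((Nat.cast_nonneg _).trans ih)
      _ = _ := by ring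

theorem candidateNum_pos (d n : ℕ) (hn : 0 < n) : 0 < candidateNum d n := by
  induction d generalizing n with
  | zero => rw [candidateNum]; cases primeCandidate n <;> simp [hn]
  | succ d ih => exact Nat.mul_pos (ih n hn) (ih (n + 2 ^ d) (Nat.add_pos_left hn _))

theorem cumulativeNum_pos (j : ℕ) : 0 < cumulativeNum j := by
  induction j with
  | zero => exact one_pos
  | succ j ih => exact Nat.mul_pos ih (candidateNum_pos _ _ (by positivity))

theorem exp_eulerMascheroniConstant_ge : (1.75 : ℝ) ≤ Real.exp Real.eulerMascheroniConstant := by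
  have h1 := Real.eulerMascheroniSeq_lt_eulerMascheroniConstant 31
  unfold Real.eulerMascheroniSeq at h1
  have h2 : (4.0272 : ℚ) ≤ harmonic 31 := by
    simp only [harmonic, sum_range_succ, sum_range_zero]
    norm_num
  have h2' : (4.0272 : ℝ) ≤ (harmonic 31 : ℝ) := by
    have : ((4.0272 : ℚ) : ℝ) ≤ (harmonic 31 : ℝ) := by exact_mod_cast h2
    norm_num at this ⊢
  have h3 : Real.log (((31 : ℕ) : ℝ) + 1) = 5 * Real.log 2 := by
    have : ((31 : ℕ) : ℝ) + 1 = 2 ^ 5 := by norm_num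
    rw [this, Real.log_pow]
    norm_num
  rw [h3] at h1
  have h4 := Real.log_two_lt_d9
  have h5 : (0.5614 : ℝ) ≤ Real.eulerMascheroniConstant := by linarith
  refine le_trans ?_ (Real.exp_le_exp.2 h5)
  refine le_trans ?_ (Real.sum_le_exp_of_nonneg (by norm_num) 6)
  simp only [sum_range_succ, sum_range_zero, Nat.factorial]
  norm_num

theorem log_three_mul_ge {q j : ℕ} (h : 2 ^ j ≤ q) :
    1.0986122 + j * 0.6931471 ≤ Real.log (3 * q) := by
  have h1 : Real.log (3 * 2 ^ j) ≤ Real.log (3 * q) :=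
    Real.log_le_log (by positivity) (by
      have : (2 : ℝ) ^ j ≤ q := by exact_mod_cast h
      linarith)
  rw [Real.log_mul (by norm_num) (by positivity), Real.log_pow] at h1
  have := Real.log_two_gt_d9
  have := Real.log_three_gt_d9
  have : (j : ℝ) * 0.6931471 ≤ j * Real.log 2 :=
    mul_le_mul_of_nonneg_left (by linarith) (by positivity)
  linarith

theorem one_le_of_primeProd_ge {q m j : ℕ} {P : ℝ} (hqm : q ≤ m) (hP : P ≤ primeProd 0 m)
    (hj : 2 ^ j ≤ q) (h : 1 ≤ 1.75 * P * (1.0986122 + j * 0.6931471)) :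
    1 ≤ Real.exp Real.eulerMascheroniConstant * (∏ r ∈ q.primesBelow, (1 - 1 / (r : ℝ))) *
      Real.log (3 * q) := by
  rw [← primeProd_zero]
  have h1 : P ≤ primeProd 0 q := hP.trans (by
    rw [← primeProd_mul (Nat.zero_le q) hqm]
    exact mul_le_of_le_one_right (primeProd_pos _ _).le (primeProd_le_one _ _))
  refine h.trans ?_
  have := primeProd_pos 0 q
  refine mul_le_mul (mul_le_mul exp_eulerMascheroniConstant_ge h1 ?_ (Real.exp_pos _).le)
    (log_three_mul_ge hj) (by positivity) (by positivity)
  by_contra hneg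
  push Not at hneg
  have : 1.75 * P * (1.0986122 + j * 0.6931471) ≤ 0 :=
    mul_nonpos_of_nonpos_of_nonneg (by linarith) (by positivity)
  linarith

theorem primeProd_zero_sixteen : primeProd 0 16 = 5760 / 30030 := by
  have : {p ∈ Ico 0 16 | p.Prime} = {2, 3, 5, 7, 11, 13} := by decide
  unfold primeProd
  rw [this]
  norm_num

theorem primeProd_zero_seven : primeProd 0 7 = 8 / 30 := by
  have : {p ∈ Ico 0 7 | p.Prime} = {2, 3, 5} := by decide
  unfold primeProd
  rw [this]
  norm_num

theorem primeProd_zero_three : primeProd 0 3 = 1 / 2 := by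
  have : {p ∈ Ico 0 3 | p.Prime} = {2} := by decide
  unfold primeProd
  rw [this]
  norm_num

/-- An explicit form of Mertens' third theorem. -/
theorem one_le_exp_mul_prod_mul_log {q : ℕ} (hq : 3 ≤ q) :
    1 ≤ Real.exp Real.eulerMascheroniConstant * (∏ r ∈ q.primesBelow, (1 - 1 / (r : ℝ))) *
      Real.log (3 * q) := by
  rcases Nat.lt_or_ge q 32768 with h | h
  · rcases Nat.lt_or_ge q 16 with h16 | h16
    · rcases Nat.lt_or_ge q 8 with h8 | h8
      · rcases Nat.lt_or_ge q 4 with h4 | h4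
        · exact one_le_of_primeProd_ge (m := 3) (j := 1) (by omega) primeProd_zero_three.ge
            (by omega) (by norm_num)
        · exact one_le_of_primeProd_ge (m := 7) (j := 2) (by omega) primeProd_zero_seven.ge
            (by omega) (by norm_num)
      · exact one_le_of_primeProd_ge (m := 16) (j := 3) (by omega) primeProd_zero_sixteen.ge
            (by omega) (by norm_num)
    · obtain ⟨j, hj⟩ : ∃ j, Nat.log 2 q = j + 4 := by
        have : 4 ≤ Nat.log 2 q := (Nat.le_log_iff_pow_le (by norm_num) (by omega)).2 (by omega)
        exact ⟨Nat.log 2 q - 4, by omega⟩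
      have h1 : 2 ^ (j + 4) ≤ q := hj ▸ Nat.pow_log_le_self 2 (by omega)
      have h2 : q < 2 ^ (j + 1 + 4) := by
        have := Nat.lt_pow_succ_log_self (b := 2) (by norm_num) q
        rw [hj] at this
        exact this
      have hj11 : j < 11 := by
        by_contra hc
        have : 2 ^ 15 ≤ 2 ^ (j + 4) := Nat.pow_le_pow_right (by norm_num) (by omega)
        omega
      have hc := cumulative_check j hj11
      have hc' : (30030 : ℝ) * cumulativeNum (j + 1) * 40000000 ≤
        5760 * cumulativeDen (j + 1) * (7 * (10986122 + (j + 4) * 6931471)) := by exact_mod_cast hc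
      have hd := cumulativeDen_le (j + 1)
      have hpos : (0 : ℝ) < cumulativeNum (j + 1) := by exact_mod_cast cumulativeNum_pos (j + 1)
      have h16' : 16 ≤ 2 ^ (j + 1 + 4) := by omega
      refine one_le_of_primeProd_ge (m := 2 ^ (j + 1 + 4)) (j := j + 4) h2.le
        (P := 5760 / 30030 * (cumulativeDen (j + 1) / cumulativeNum (j + 1))) ?_ h1 ?_
      · rw [← primeProd_mul (Nat.zero_le 16) h16', primeProd_zero_sixteen]
        refine mul_le_mul_of_nonneg_left ?_ (by norm_num)
        rw [div_le_iff₀ hpos]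
        linarith
      · push_cast
        have e : 1.75 * (5760 / 30030 * ((cumulativeDen (j + 1) : ℝ) / cumulativeNum (j + 1))) *
            (1.0986122 + (j + 4) * 0.6931471) =
            (5760 * cumulativeDen (j + 1) * (7 * (10986122 + (j + 4) * 6931471))) /
            (30030 * cumulativeNum (j + 1) * 40000000) := by
          field_simp
          ring
        rw [e, one_le_div (by positivity)]
        exact hc'
  · have h1 := neg_log_prod_le_of_large h
    rw [← primeProd_zero] at h1 ⊢
    have hq1 : (1 : ℝ) < 3 * q := by
      have : (3 : ℝ) ≤ q := by exact_mod_cast hq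
      linarith
    have hl : 0 < Real.log (3 * q) := Real.log_pos hq1
    have hp := primeProd_pos 0 q
    have h2 : 0 ≤ Real.log (Real.exp Real.eulerMascheroniConstant * primeProd 0 q *
        Real.log (3 * q)) := by
      rw [Real.log_mul (by positivity) hl.ne', Real.log_mul (by positivity) hp.ne', Real.log_exp]
      linarith
    exact (Real.log_nonneg_iff (by positivity)).1 h2
end

section
open Finset

/-- The largest prime factor of `a`, or `0` if there is none. -/
def maxPrimeFac (a : ℕ) : ℕ := a.primeFactors.sup id

theorem le_maxPrimeFac {a r : ℕ} (ha : a ≠ 0) (hr : r.Prime) (h : r ∣ a) : r ≤ maxPrimeFac a :=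
  le_sup (f := id) (Nat.mem_primeFactors.2 ⟨hr, h, ha⟩)

theorem maxPrimeFac_mem {a : ℕ} (ha : 1 < a) : maxPrimeFac a ∈ a.primeFactors := by
  obtain ⟨i, hi, h⟩ := exists_mem_eq_sup a.primeFactors (Nat.nonempty_primeFactors.2 ha) id
  rw [maxPrimeFac, h]
  exact hi

/-- The product of the primes below `y`. -/
def primesBelowProd (y : ℕ) : ℕ := ∏ r ∈ y.primesBelow, r

theorem primesBelowProd_pos (y : ℕ) : 0 < primesBelowProd y :=
  prod_pos fun _ hr => (Nat.mem_primesBelow.1 hr).2.pos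

theorem prime_dvd_primesBelowProd {r y : ℕ} (hr : r.Prime) (h : r < y) : r ∣ primesBelowProd y :=
  dvd_prod_of_mem _ (Nat.mem_primesBelow.2 ⟨h, hr⟩)

theorem primesBelowProd_dvd {y z : ℕ} (h : y ≤ z) : primesBelowProd y ∣ primesBelowProd z :=
  prod_dvd_prod_of_subset _ _ _ fun r hr => by
    rw [Nat.mem_primesBelow] at hr ⊢
    exact ⟨hr.1.trans_le h, hr.2⟩

theorem coprime_primesBelowProd {y n : ℕ} (h : ∀ r, r.Prime → r < y → ¬ r ∣ n) :
    (primesBelowProd y).Coprime n :=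
  Nat.Coprime.prod_left fun r hr =>
    ((Nat.mem_primesBelow.1 hr).2.coprime_iff_not_dvd).2
      (h r (Nat.mem_primesBelow.1 hr).2 (Nat.mem_primesBelow.1 hr).1)

theorem totient_primesBelowProd (y : ℕ) : ((primesBelowProd y).totient : ℝ) =
    primesBelowProd y * ∏ r ∈ y.primesBelow, (1 - 1 / (r : ℝ)) := by
  have h := Nat.totient_eq_mul_prod_factors (primesBelowProd y)
  have e : (primesBelowProd y).primeFactors = y.primesBelow :=
    Nat.primeFactors_prod fun r hr => (Nat.mem_primesBelow.1 hr).2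
  rw [e] at h
  have h' : (((primesBelowProd y).totient : ℚ) : ℝ) =
      ((primesBelowProd y * ∏ r ∈ y.primesBelow, (1 - (r : ℚ)⁻¹) : ℚ) : ℝ) := by rw [h]
  push_cast at h'
  rw [h']
  simp only [one_div]

theorem card_coprime_Ioc (Q t : ℕ) : #{k ∈ Ioc 0 (Q * t) | Q.Coprime k} = Q.totient * t := by
  induction t with
  | zero => simp
  | succ t ih =>
    have e : Ioc 0 (Q * (t + 1)) = Ioc 0 (Q * t) ∪ Ico (Q * t + 1) (Q * t + 1 + Q) := by
      ext k
      simp only [mem_Ioc, mem_union, mem_Ico, mul_add, mul_one]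
      omega
    have hd : Disjoint (Ioc 0 (Q * t)) (Ico (Q * t + 1) (Q * t + 1 + Q)) := by
      rw [disjoint_left]
      intro k hk hk'
      simp only [mem_Ioc, mem_Ico] at hk hk'
      omega
    rw [e, filter_union, card_union_of_disjoint (disjoint_filter_filter hd), ih,
      Nat.filter_coprime_Ico_eq_totient]
    ring

/-- The multiples `n ≤ N` of `a` such that `n / a` has no prime factor below `y`. -/
def roughMultiples (N a y : ℕ) : Finset ℕ :=
  {n ∈ Ioc 0 N | a ∣ n ∧ (primesBelowProd y).Coprime (n / a)}

theorem card_roughMultiples {N a y : ℕ} (ha : 0 < a) (h : a * primesBelowProd y ∣ N) :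
    (#(roughMultiples N a y) : ℝ) =
      N * (1 / a * ∏ r ∈ y.primesBelow, (1 - 1 / (r : ℝ))) := by
  obtain ⟨t, rfl⟩ := h
  have e : roughMultiples (a * primesBelowProd y * t) a y =
      {k ∈ Ioc 0 (primesBelowProd y * t) | (primesBelowProd y).Coprime k}.image (a * ·) := by
    ext n
    simp only [roughMultiples, mem_filter, mem_image, mem_Ioc]
    constructor
    · rintro ⟨⟨h1, h2⟩, ⟨k, rfl⟩, h3⟩
      rw [Nat.mul_div_cancel_left _ ha] at h3
      refine ⟨k, ⟨⟨Nat.pos_of_mul_pos_left h1, ?_⟩, h3⟩, rfl⟩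
      rw [mul_assoc] at h2
      exact Nat.le_of_mul_le_mul_left h2 ha
    · rintro ⟨k, ⟨⟨h1, h2⟩, h3⟩, rfl⟩
      refine ⟨⟨Nat.mul_pos ha h1, ?_⟩, Dvd.intro _ rfl, ?_⟩
      · rw [mul_assoc]
        exact Nat.mul_le_mul_left a h2
      · rwa [Nat.mul_div_cancel_left _ ha]
  have hinj : Function.Injective (a * · : ℕ → ℕ) := fun x y hxy => Nat.eq_of_mul_eq_mul_left ha hxy
  rw [e, card_image_of_injective _ hinj, card_coprime_Ioc]
  have ha' : (a : ℝ) ≠ 0 := by exact_mod_cast ha.ne'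
  push_cast
  rw [totient_primesBelowProd]
  field_simp

theorem not_dvd_of_mem_roughMultiples {N a y n r : ℕ} (h : n ∈ roughMultiples N a y)
    (hr : r.Prime) (hry : r < y) : ¬ r ∣ n / a := fun hd => by
  have h1 := (mem_filter.1 h).2.2
  exact Nat.not_coprime_of_dvd_of_dvd hr.one_lt (prime_dvd_primesBelowProd hr hry) hd h1

theorem dvd_of_mem_roughMultiples {N a b n : ℕ} (ha : 1 < a) (hb : 1 < b)
    (hna : n ∈ roughMultiples N a (maxPrimeFac a)) (hnb : n ∈ roughMultiples N b (maxPrimeFac b))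
    (hle : maxPrimeFac a ≤ maxPrimeFac b)
    (hv : a.factorization (maxPrimeFac b) ≤ b.factorization (maxPrimeFac b)) : a ∣ b := by
  have hn0 : n ≠ 0 := by
    have := (mem_Ioc.1 (mem_filter.1 hna).1).1
    omega
  have han := (mem_filter.1 hna).2.1
  have hbn := (mem_filter.1 hnb).2.1
  rw [← Nat.factorization_prime_le_iff_dvd (by omega) (by omega)]
  intro r hr
  rcases lt_trichotomy r (maxPrimeFac b) with h | h | h
  · have h1 := not_dvd_of_mem_roughMultiples hnb hr h
    have h2 : n.factorization r = b.factorization r := by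
      conv_lhs => rw [← Nat.mul_div_cancel' hbn]
      have hnz : n / b ≠ 0 := by
        rintro h0
        rw [h0] at h1
        exact h1 (dvd_zero r)
      rw [Nat.factorization_mul (by omega) hnz, Finsupp.add_apply,
        Nat.factorization_eq_zero_of_not_dvd h1, add_zero]
    rw [← h2]
    exact (Nat.factorization_le_iff_dvd (by omega) hn0).2 han r
  · rw [h]; exact hv
  · rw [Nat.factorization_eq_zero_of_not_dvd fun hd => ?_]
    · exact Nat.zero_le _
    · have := le_maxPrimeFac (by omega) hr hd
      omega

theorem dvd_or_dvd_of_mem_roughMultiples {N a b n : ℕ} (ha : 1 < a) (hb : 1 < b)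
    (hna : n ∈ roughMultiples N a (maxPrimeFac a))
    (hnb : n ∈ roughMultiples N b (maxPrimeFac b)) : a ∣ b ∨ b ∣ a := by
  have key {a b : ℕ} (ha : 1 < a) (h : maxPrimeFac a < maxPrimeFac b) :
      a.factorization (maxPrimeFac b) = 0 := by
    by_contra hne
    have hm : maxPrimeFac b ∈ a.primeFactors := by
      rw [← Nat.support_factorization]
      exact Finsupp.mem_support_iff.2 hne
    have := le_maxPrimeFac (by omega) (Nat.prime_of_mem_primeFactors hm)
      (Nat.dvd_of_mem_primeFactors hm)
    omega
  rcases lt_trichotomy (maxPrimeFac a) (maxPrimeFac b) with h | h | h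
  · exact Or.inl (dvd_of_mem_roughMultiples ha hb hna hnb h.le (by rw [key ha h]; omega))
  · rcases le_total (a.factorization (maxPrimeFac b)) (b.factorization (maxPrimeFac b)) with h' | h'
    · exact Or.inl (dvd_of_mem_roughMultiples ha hb hna hnb h.le h')
    · exact Or.inr (dvd_of_mem_roughMultiples hb ha hnb hna h.ge (by rwa [h]))
  · exact Or.inr (dvd_of_mem_roughMultiples hb ha hnb hna h.le (by rw [key hb h]; omega))

theorem sum_rough_density_le {S : Finset ℕ} {p : ℕ} (hp : p.Prime) (hone : ∀ a ∈ S, 1 < a)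
    (hprim : ∀ a ∈ S, ∀ b ∈ S, a ≠ b → ¬ a ∣ b) (hmin : ∀ a ∈ S, a.minFac = p) :
    ∑ a ∈ S, 1 / (a : ℝ) * ∏ r ∈ (maxPrimeFac a).primesBelow, (1 - 1 / (r : ℝ)) ≤ g p := by
  set Y := S.sup maxPrimeFac ⊔ p with hY
  set N := (∏ a ∈ S, a) * p * primesBelowProd Y with hN
  have hN0 : 0 < N :=
    Nat.mul_pos (Nat.mul_pos (prod_pos fun a ha => by have := hone a ha; omega) hp.pos)
      (primesBelowProd_pos _)
  have hN0' : (0 : ℝ) < N := by exact_mod_cast hN0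
  have hcard : ∀ a ∈ S, (#(roughMultiples N a (maxPrimeFac a)) : ℝ) =
      N * (1 / a * ∏ r ∈ (maxPrimeFac a).primesBelow, (1 - 1 / (r : ℝ))) := by
    intro a ha
    refine card_roughMultiples (by have := hone a ha; omega) ?_
    exact mul_dvd_mul ((dvd_prod_of_mem _ ha).mul_right p)
      (primesBelowProd_dvd ((le_sup ha).trans le_sup_left))
  have hcardp : (#(roughMultiples N p p) : ℝ) = N * g p :=
    card_roughMultiples hp.pos (mul_dvd_mul (Dvd.intro_left _ rfl)
      (primesBelowProd_dvd le_sup_right))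
  have hdisj : (S : Set ℕ).PairwiseDisjoint fun a => roughMultiples N a (maxPrimeFac a) := by
    intro a ha b hb hab
    rw [Function.onFun, disjoint_left]
    intro n hna hnb
    rcases dvd_or_dvd_of_mem_roughMultiples (hone a ha) (hone b hb) hna hnb with h | h
    · exact hprim a ha b hb hab h
    · exact hprim b hb a ha hab.symm h
  have hsub : S.biUnion (fun a => roughMultiples N a (maxPrimeFac a)) ⊆ roughMultiples N p p := by
    intro n hn
    obtain ⟨a, ha, hna⟩ := mem_biUnion.1 hn
    have hpa : p ∣ a := hmin a ha ▸ Nat.minFac_dvd a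
    have han := (mem_filter.1 hna).2.1
    refine mem_filter.2 ⟨(mem_filter.1 hna).1, hpa.trans han, coprime_primesBelowProd ?_⟩
    intro r hr hrp hd
    have hpP : p ≤ maxPrimeFac a := le_maxPrimeFac (by have := hone a ha; omega) hp hpa
    have e : n / p = a / p * (n / a) := by
      obtain ⟨c, rfl⟩ := hpa
      obtain ⟨m, rfl⟩ := han
      have hc : 0 < p * c := by have := hone _ ha; omega
      rw [Nat.mul_div_cancel_left _ hc, Nat.mul_div_cancel_left _ hp.pos, mul_assoc,
        Nat.mul_div_cancel_left _ hp.pos]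
    rw [e] at hd
    rcases hr.dvd_mul.1 hd with h | h
    · have := Nat.minFac_le_of_dvd hr.two_le (h.trans (Nat.div_dvd_of_dvd hpa))
      rw [hmin a ha] at this
      omega
    · exact not_dvd_of_mem_roughMultiples hna hr (hrp.trans_le hpP) h
  have h1 : (#(S.biUnion fun a => roughMultiples N a (maxPrimeFac a)) : ℝ) ≤ N * g p := by
    rw [← hcardp]
    exact_mod_cast card_le_card hsub
  rw [card_biUnion hdisj] at h1
  push_cast at h1
  rw [sum_congr rfl hcard, ← mul_sum] at h1
  exact le_of_mul_le_mul_left h1 hN0'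
end

section
open Finset

theorem g_pos {p : ℕ} (hp : p.Prime) : 0 < g p := by
  have : (0 : ℝ) < p := by exact_mod_cast hp.pos
  unfold g
  refine mul_pos (by positivity) (prod_pos fun r hr => ?_)
  exact (one_sub_one_div_prime_mem (Nat.mem_primesBelow.1 hr).2).1

theorem sum_primesBelow_g (n : ℕ) :
    ∑ p ∈ n.primesBelow, g p = 1 - ∏ r ∈ n.primesBelow, (1 - 1 / (r : ℝ)) := by
  induction n with
  | zero => simp
  | succ n ih =>
    rw [Nat.primesBelow_succ]
    split_ifs
    · rw [sum_insert (Nat.notMem_primesBelow n), prod_insert (Nat.notMem_primesBelow n), ih, g]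
      ring
    · exact ih

theorem summable_indicator_g : Summable ({p : ℕ | p.Prime}.indicator g) := by
  refine summable_of_sum_range_le (c := 1)
    (fun p => Set.indicator_nonneg (fun p hp => (g_pos hp).le) p) fun n => ?_
  have h : ∑ p ∈ range n, {p : ℕ | p.Prime}.indicator g p = ∑ p ∈ n.primesBelow, g p := by
    rw [Nat.primesBelow, sum_filter]
    refine sum_congr rfl fun p _ => ?_
    by_cases hp : p.Prime <;> simp [hp]
  rw [h, sum_primesBelow_g, sub_le_self_iff]
  exact prod_nonneg fun r hr => (one_sub_one_div_prime_mem (Nat.mem_primesBelow.1 hr).2).1.le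

theorem one_div_mul_log_le_g {p : ℕ} (h2 : 2 < p) :
    1 / (p * Real.log p) ≤ 2 * Real.exp Real.eulerMascheroniConstant * g p := by
  have hp3 : (3 : ℝ) ≤ p := by exact_mod_cast h2
  have hl : 0 < Real.log p := Real.log_pos (by linarith)
  have h1 := one_le_exp_mul_prod_mul_log (q := p) h2
  have hlog : Real.log (3 * p) ≤ 2 * Real.log p := by
    have : Real.log (3 * p) ≤ Real.log ((p : ℝ) ^ 2) :=
      Real.log_le_log (by positivity) (by nlinarith)
    rwa [Real.log_pow, Nat.cast_ofNat] at this
  have hpos : 0 < ∏ r ∈ p.primesBelow, (1 - 1 / (r : ℝ)) :=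
    prod_pos fun r hr => (one_sub_one_div_prime_mem (Nat.mem_primesBelow.1 hr).2).1
  have h3 := h1.trans (mul_le_mul_of_nonneg_left hlog (mul_pos (Real.exp_pos _) hpos).le)
  rw [div_le_iff₀ (by positivity), g]
  refine h3.trans (le_of_eq ?_)
  field_simp

theorem one_div_mul_log_le_of_composite {a : ℕ} (ha : 1 < a) (hodd : Odd a) (hnp : ¬ a.Prime) :
    1 / (a * Real.log a) ≤ Real.exp Real.eulerMascheroniConstant *
      (1 / (a : ℝ) * ∏ r ∈ (maxPrimeFac a).primesBelow, (1 - 1 / (r : ℝ))) := by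
  have hm := maxPrimeFac_mem ha
  have hP := Nat.prime_of_mem_primeFactors hm
  have hPodd : Odd (maxPrimeFac a) := hodd.of_dvd_nat (Nat.dvd_of_mem_primeFactors hm)
  have hP3 : 3 ≤ maxPrimeFac a := by
    have := hP.two_le
    obtain ⟨k, hk⟩ := hPodd
    omega
  have h3 : 3 * maxPrimeFac a ≤ a := by
    obtain ⟨c, hc⟩ := Nat.dvd_of_mem_primeFactors hm
    have hcodd : Odd c := hodd.of_dvd_nat (Dvd.intro_left _ hc.symm)
    have hc1 : c ≠ 1 := by
      rintro rfl
      rw [mul_one] at hc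
      exact hnp (hc ▸ hP)
    have hc3 : 3 ≤ c := by
      obtain ⟨k, hk⟩ := hcodd
      omega
    calc 3 * maxPrimeFac a ≤ c * maxPrimeFac a := Nat.mul_le_mul_right _ hc3
      _ = a := by rw [mul_comm]; exact hc.symm
  have h1 := one_le_exp_mul_prod_mul_log hP3
  have hpos : 0 < ∏ r ∈ (maxPrimeFac a).primesBelow, (1 - 1 / (r : ℝ)) :=
    prod_pos fun r hr => (one_sub_one_div_prime_mem (Nat.mem_primesBelow.1 hr).2).1
  have ha0 : (1 : ℝ) < a := by exact_mod_cast ha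
  have hl : 0 < Real.log a := Real.log_pos ha0
  have hlog : Real.log (3 * maxPrimeFac a) ≤ Real.log a :=
    Real.log_le_log (by have := hP.pos; positivity) (by exact_mod_cast h3)
  have h4 := h1.trans (mul_le_mul_of_nonneg_left hlog (mul_pos (Real.exp_pos _) hpos).le)
  rw [div_le_iff₀ (by positivity)]
  refine h4.trans (le_of_eq ?_)
  field_simp

/-- The odd primes that are not Mertens. -/
def oddNonMertens : Set ℕ := {p : ℕ | p.Prime ∧ 2 < p ∧ ¬ IsMertens p}

/-- The summand of `eps0`. -/
noncomputable def mertensExcess (p : ℕ) : ℝ :=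
  Real.exp Real.eulerMascheroniConstant * g p - 1 / ((p : ℕ) * Real.log (p : ℕ))

theorem isMertens_iff {p : ℕ} (hp : p.Prime) : IsMertens p ↔ mertensExcess p ≤ 0 := by
  have hp0 : (0 : ℝ) < p := by exact_mod_cast hp.pos
  have e : mertensExcess p = 1 / p * (Real.exp Real.eulerMascheroniConstant *
      ∏ r ∈ p.primesBelow, (1 - 1 / (r : ℝ)) - 1 / Real.log p) := by
    rw [mertensExcess, g, ← one_div_mul_one_div]
    ring
  rw [e, IsMertens]
  constructor
  · intro h
    exact mul_nonpos_of_nonneg_of_nonpos (by positivity) (by linarith)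
  · intro h
    by_contra hc
    have : 0 < 1 / (p : ℝ) * (Real.exp Real.eulerMascheroniConstant *
      ∏ r ∈ p.primesBelow, (1 - 1 / (r : ℝ)) - 1 / Real.log p) :=
      mul_pos (by positivity) (by linarith)
    linarith

theorem mertensExcess_nonneg_of_mem {p : ℕ} (hp : p ∈ oddNonMertens) : 0 ≤ mertensExcess p := by
  have h := hp.2.2
  rw [isMertens_iff hp.1] at h
  linarith

theorem summable_indicator_mertensExcess : Summable (oddNonMertens.indicator mertensExcess) := by
  refine Summable.of_nonneg_of_le
    (fun p => Set.indicator_nonneg (fun p hp => mertensExcess_nonneg_of_mem hp) p) (fun p => ?_)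
    (summable_indicator_g.mul_left (Real.exp Real.eulerMascheroniConstant))
  by_cases hp : p ∈ oddNonMertens
  · have hp' : p ∈ {p : ℕ | p.Prime} := hp.1
    rw [Set.indicator_of_mem hp, Set.indicator_of_mem hp', mertensExcess]
    have := Real.log_natCast_nonneg p
    have : 0 ≤ 1 / ((p : ℝ) * Real.log p) := by positivity
    linarith
  · rw [Set.indicator_of_notMem hp]
    exact mul_nonneg (Real.exp_pos _).le
      (Set.indicator_nonneg (fun p hp => (g_pos hp).le) p)

theorem summable_indicator_one_div_mul_log {s : Set ℕ} (hs : ∀ p ∈ s, p.Prime ∧ 2 < p) :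
    Summable (s.indicator fun p => 1 / ((p : ℕ) * Real.log (p : ℕ))) := by
  have hnn : ∀ p : ℕ, 0 ≤ 1 / ((p : ℝ) * Real.log p) := fun p => by
    have := Real.log_natCast_nonneg p
    positivity
  refine Summable.of_nonneg_of_le (fun p => Set.indicator_nonneg (fun p _ => hnn p) p)
    (fun p => ?_)
    (summable_indicator_g.mul_left (2 * Real.exp Real.eulerMascheroniConstant))
  by_cases hp : p ∈ s
  · have hp' : p ∈ {p : ℕ | p.Prime} := (hs p hp).1
    rw [Set.indicator_of_mem hp, Set.indicator_of_mem hp']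
    exact one_div_mul_log_le_g (hs p hp).2
  · rw [Set.indicator_of_notMem hp]
    exact mul_nonneg (by positivity) (Set.indicator_nonneg (fun p hp => (g_pos hp).le) p)

theorem sum_same_minFac_le {S : Finset ℕ} {p : ℕ} (hp : p.Prime) (h2 : 2 < p)
    (hone : ∀ a ∈ S, 1 < a) (hodd : ∀ a ∈ S, Odd a)
    (hprim : ∀ a ∈ S, ∀ b ∈ S, a ≠ b → ¬ a ∣ b) (hmin : ∀ a ∈ S, a.minFac = p) :
    ∑ a ∈ S, 1 / ((a : ℝ) * Real.log a) ≤
      1 / (p * Real.log p) + oddNonMertens.indicator mertensExcess p := by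
  have hnn : 0 ≤ oddNonMertens.indicator mertensExcess p :=
    Set.indicator_nonneg (fun p hp => mertensExcess_nonneg_of_mem hp) p
  by_cases hpS : p ∈ S
  · have hS : S = {p} := by
      refine eq_singleton_iff_unique_mem.2 ⟨hpS, fun a ha => ?_⟩
      by_contra hne
      exact hprim p hpS a ha (Ne.symm hne) (hmin a ha ▸ Nat.minFac_dvd a)
    rw [hS, sum_singleton]
    linarith
  · have h1 : ∑ a ∈ S, 1 / ((a : ℝ) * Real.log a) ≤
        Real.exp Real.eulerMascheroniConstant * g p := by
      refine le_trans ?_ (mul_le_mul_of_nonneg_left (sum_rough_density_le hp hone hprim hmin)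
        (Real.exp_pos _).le)
      rw [mul_sum]
      refine sum_le_sum fun a ha => one_div_mul_log_le_of_composite (hone a ha) (hodd a ha) ?_
      intro hap
      exact hpS (by rw [← hmin a ha, hap.minFac_eq]; exact ha)
    have h3 : Real.exp Real.eulerMascheroniConstant * g p =
        1 / (p * Real.log p) + mertensExcess p := by rw [mertensExcess]; ring
    rw [h3] at h1
    refine h1.trans (add_le_add_right ?_ _)
    by_cases hM : p ∈ oddNonMertens
    · rw [Set.indicator_of_mem hM]
    · rw [Set.indicator_of_notMem hM]
      refine (isMertens_iff hp).1 ?_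
      by_contra hc
      exact hM ⟨hp, h2, hc⟩

theorem sum_finset_le {A : Set ℕ} (hA : IsPrimitive A) (hodd : ∀ a ∈ A, Odd a) {S : Finset ℕ}
    (hS : (S : Set ℕ) ⊆ A) :
    ∑ a ∈ S, 1 / ((a : ℝ) * Real.log a) ≤
      (∑' p : primeSupport A, 1 / ((p : ℕ) * Real.log (p : ℕ))) + eps0 := by
  have hsupp : ∀ p ∈ primeSupport A, p.Prime ∧ 2 < p := by
    rintro p ⟨hp, a, ha, hpa⟩
    refine ⟨hp, ?_⟩
    have := hp.two_le
    obtain ⟨k, hk⟩ := (hodd a ha).of_dvd_nat hpa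
    omega
  have hT : ∀ p ∈ S.image Nat.minFac, p ∈ primeSupport A := by
    intro p hp
    obtain ⟨a, ha, rfl⟩ := mem_image.1 hp
    exact ⟨Nat.minFac_prime (hA.1 a (hS ha)).ne', a, hS ha, Nat.minFac_dvd a⟩
  have hnn : ∀ p : ℕ, 0 ≤ 1 / ((p : ℝ) * Real.log p) := fun p => by
    have := Real.log_natCast_nonneg p
    positivity
  rw [← sum_fiberwise_of_maps_to (g := Nat.minFac) (t := S.image Nat.minFac)
    (fun a ha => mem_image_of_mem _ ha)]
  have h1 : ∀ p ∈ S.image Nat.minFac, ∑ a ∈ S with a.minFac = p, 1 / ((a : ℝ) * Real.log a) ≤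
      (primeSupport A).indicator (fun p => 1 / ((p : ℕ) * Real.log (p : ℕ))) p +
        oddNonMertens.indicator mertensExcess p := by
    intro p hp
    rw [Set.indicator_of_mem (hT p hp)]
    have hsub : ∀ a ∈ S.filter (fun a => a.minFac = p), a ∈ A := fun a ha =>
      hS (mem_filter.1 ha).1
    exact sum_same_minFac_le (hsupp p (hT p hp)).1 (hsupp p (hT p hp)).2
      (fun a ha => hA.1 a (hsub a ha)) (fun a ha => hodd a (hsub a ha))
      (fun a ha b hb => hA.2 a (hsub a ha) b (hsub b hb)) (fun a ha => (mem_filter.1 ha).2)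
  refine (sum_le_sum h1).trans ?_
  rw [sum_add_distrib]
  refine add_le_add ?_ ?_
  · rw [tsum_subtype (primeSupport A) fun p : ℕ => 1 / ((p : ℕ) * Real.log (p : ℕ))]
    exact (summable_indicator_one_div_mul_log hsupp).sum_le_tsum _
      fun p _ => Set.indicator_nonneg (fun p _ => hnn p) p
  · have e : eps0 = ∑' p, oddNonMertens.indicator mertensExcess p :=
      tsum_subtype oddNonMertens mertensExcess
    rw [e]
    exact summable_indicator_mertensExcess.sum_le_tsum _
      fun p _ => Set.indicator_nonneg (fun p hp => mertensExcess_nonneg_of_mem hp) p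
end

theorem odd_primitive_f_le (A : Set ℕ) (hA : IsPrimitive A)
    (hodd : ∀ a ∈ A, Odd a) :
    f A ≤ (∑' p : primeSupport A, 1 / ((p : ℕ) * Real.log (p : ℕ))) + eps0 := by
  have h0 := sum_finset_le hA hodd (S := ∅) (by simp)
  rw [Finset.sum_empty] at h0
  refine tsum_le_of_sum_le' h0 fun s => ?_
  have h1 := sum_finset_le hA hodd (S := s.map (Function.Embedding.subtype _)) (by
    intro a ha
    simp only [Finset.coe_map, Function.Embedding.subtype_apply, Set.mem_image] at ha
    obtain ⟨x, _, rfl⟩ := ha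
    exact x.2)
  rw [Finset.sum_map] at h1
  exact h1
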